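/- Let g be a Lie superalgebra over ℂ and t ⊆ g a Lie subsuperalgebra such that g is finitely semisimple as a t-supermodule under the adjoint action. Let 𝒟 be a full subcategory of 𝒞_{(g,t)} closed under direct sums and such that whenever a finite-dimensional simple t-supermodule L appears as a composition factor of an object of 𝒟, the induced supermodule L̂ = U(g) ⊗_{U(t)} L lies in 𝒟. Then 𝒟 has enough projectives, and for all objects M, N of 𝒟 and all p ≥ 0 there is an isomorphism of superspaces Ext^p_𝒟(M,N) ≅ Ext^p_{(U(g),U(t))}(M,N). -/

import Mathlib

/-!
Core definitions: complex Lie superalgebras, supermodules, (even) morphisms,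
subsuperalgebras, invariant subsupermodules, finite semisimplicity.
A Lie superalgebra `g = g₀ ⊕ g₁` is presented by its even part `V0`, odd part `V1`
and the three graded components of the bracket, subject to graded antisymmetry
and the graded Jacobi identity.
-/

noncomputable section

open scoped BigOperators

/-- A complex Lie superalgebra `g = g₀ ⊕ g₁`. -/
structure LieSuperalgebra : Type 1 where
  V0 : Type
  V1 : Type
  [add0 : AddCommGroup V0]
  [mod0 : Module ℂ V0]
  [add1 : AddCommGroup V1]
  [mod1 : Module ℂ V1]
  b00 : V0 →ₗ[ℂ] V0 →ₗ[ℂ] V0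
  b01 : V0 →ₗ[ℂ] V1 →ₗ[ℂ] V1
  b11 : V1 →ₗ[ℂ] V1 →ₗ[ℂ] V0
  b00_skew : ∀ x y, b00 x y = - b00 y x
  b11_symm : ∀ u v, b11 u v = b11 v u
  jacobi_000 : ∀ x y z, b00 x (b00 y z) = b00 (b00 x y) z + b00 y (b00 x z)
  jacobi_001 : ∀ x y u, b01 x (b01 y u) = b01 (b00 x y) u + b01 y (b01 x u)
  jacobi_011 : ∀ x u v, b00 x (b11 u v) = b11 (b01 x u) v + b11 u (b01 x v)
  jacobi_111 : ∀ u v w, b01 (b11 u v) w + b01 (b11 v w) u + b01 (b11 w u) v = 0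

attribute [instance] LieSuperalgebra.add0 LieSuperalgebra.mod0
attribute [instance] LieSuperalgebra.add1 LieSuperalgebra.mod1

/-- A supermodule `M = M₀ ⊕ M₁` over a Lie superalgebra `g`, given by the four
graded components of the action, subject to the graded module axioms. -/
structure SuperModule (g : LieSuperalgebra) : Type 1 where
  M0 : Type
  M1 : Type
  [madd0 : AddCommGroup M0]
  [mmod0 : Module ℂ M0]
  [madd1 : AddCommGroup M1]
  [mmod1 : Module ℂ M1]
  a00 : g.V0 →ₗ[ℂ] M0 →ₗ[ℂ] M0
  a01 : g.V0 →ₗ[ℂ] M1 →ₗ[ℂ] M1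
  a10 : g.V1 →ₗ[ℂ] M0 →ₗ[ℂ] M1
  a11 : g.V1 →ₗ[ℂ] M1 →ₗ[ℂ] M0
  rel_00_0 : ∀ x y m, a00 (g.b00 x y) m = a00 x (a00 y m) - a00 y (a00 x m)
  rel_00_1 : ∀ x y m, a01 (g.b00 x y) m = a01 x (a01 y m) - a01 y (a01 x m)
  rel_01_0 : ∀ x u m, a10 (g.b01 x u) m = a01 x (a10 u m) - a10 u (a00 x m)
  rel_01_1 : ∀ x u m, a11 (g.b01 x u) m = a00 x (a11 u m) - a11 u (a01 x m)
  rel_11_0 : ∀ u v m, a00 (g.b11 u v) m = a11 u (a10 v m) + a11 v (a10 u m)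
  rel_11_1 : ∀ u v m, a01 (g.b11 u v) m = a10 u (a11 v m) + a10 v (a11 u m)

attribute [instance] SuperModule.madd0 SuperModule.mmod0
attribute [instance] SuperModule.madd1 SuperModule.mmod1

namespace SuperModule

variable {g : LieSuperalgebra}

/-- The trivial one-dimensional (purely even) supermodule `ℂ`. -/
def trivial (g : LieSuperalgebra) : SuperModule g where
  M0 := ℂ
  M1 := PUnit
  a00 := 0
  a01 := 0
  a10 := 0
  a11 := 0
  rel_00_0 := by intros; simp
  rel_00_1 := by intros; simp
  rel_01_0 := by intros; simp
  rel_01_1 := by intros; simp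
  rel_11_0 := by intros; simp
  rel_11_1 := by intros; simp

/-- The pair of linear maps `f` is an (even) morphism of `g`-supermodules `M → N`. -/
def IsHom (M N : SuperModule g)
    (f : (M.M0 →ₗ[ℂ] N.M0) × (M.M1 →ₗ[ℂ] N.M1)) : Prop :=
  (∀ x m, f.1 (M.a00 x m) = N.a00 x (f.1 m)) ∧
  (∀ x m, f.2 (M.a01 x m) = N.a01 x (f.2 m)) ∧
  (∀ u m, f.2 (M.a10 u m) = N.a10 u (f.1 m)) ∧
  (∀ u m, f.1 (M.a11 u m) = N.a11 u (f.2 m))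

/-- The ℂ-vector space of even morphisms `M → N`. -/
def HomS (M N : SuperModule g) :
    Submodule ℂ ((M.M0 →ₗ[ℂ] N.M0) × (M.M1 →ₗ[ℂ] N.M1)) where
  carrier := {f | IsHom M N f}
  add_mem' := by
    rintro f f' ⟨h1, h2, h3, h4⟩ ⟨h1', h2', h3', h4'⟩
    exact ⟨fun x m => by simp [h1, h1'], fun x m => by simp [h2, h2'],
      fun u m => by simp [h3, h3'], fun u m => by simp [h4, h4']⟩
  zero_mem' := ⟨fun x m => by simp, fun x m => by simp, fun u m => by simp,
    fun u m => by simp⟩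
  smul_mem' := by
    rintro c f ⟨h1, h2, h3, h4⟩
    exact ⟨fun x m => by simp [h1], fun x m => by simp [h2],
      fun u m => by simp [h3], fun u m => by simp [h4]⟩

/-- `M` and `N` are isomorphic `g`-supermodules. -/
def Iso (M N : SuperModule g) : Prop :=
  ∃ f, IsHom M N f ∧ Function.Bijective f.1 ∧ Function.Bijective f.2

/-- A supermodule is finite dimensional if both its graded pieces are. -/
def IsFiniteDimensional (M : SuperModule g) : Prop :=
  FiniteDimensional ℂ M.M0 ∧ FiniteDimensional ℂ M.M1

end SuperModule

/-- A Lie subsuperalgebra `t ⊆ g`, given by a pair of subspaces closed under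
the bracket. -/
structure SubSuperalgebra (g : LieSuperalgebra) where
  t0 : Submodule ℂ g.V0
  t1 : Submodule ℂ g.V1
  closed00 : ∀ x ∈ t0, ∀ y ∈ t0, g.b00 x y ∈ t0
  closed01 : ∀ x ∈ t0, ∀ u ∈ t1, g.b01 x u ∈ t1
  closed11 : ∀ u ∈ t1, ∀ v ∈ t1, g.b11 u v ∈ t0

namespace SubSuperalgebra

variable {g : LieSuperalgebra}

/-- The even part `g₀` viewed as a subsuperalgebra of `g`. -/
def evenPart (g : LieSuperalgebra) : SubSuperalgebra g where
  t0 := ⊤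
  t1 := ⊥
  closed00 := fun _ _ _ _ => trivial
  closed01 := by
    rintro x - u hu
    simp only [Submodule.mem_bot] at hu ⊢
    simp [hu]
  closed11 := fun _ _ _ _ => trivial

/-- A `t`-invariant subsupermodule (pair of subspaces) of a `g`-supermodule `M`. -/
structure TSub (t : SubSuperalgebra g) (M : SuperModule g) where
  S0 : Submodule ℂ M.M0
  S1 : Submodule ℂ M.M1
  inv00 : ∀ z ∈ t.t0, ∀ m ∈ S0, M.a00 z m ∈ S0
  inv01 : ∀ z ∈ t.t0, ∀ m ∈ S1, M.a01 z m ∈ S1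
  inv10 : ∀ z ∈ t.t1, ∀ m ∈ S0, M.a10 z m ∈ S1
  inv11 : ∀ z ∈ t.t1, ∀ m ∈ S1, M.a11 z m ∈ S0

/-- A `t`-invariant subsupermodule is simple if it is nonzero and admits no proper
nonzero `t`-invariant subsupermodule. -/
def TSub.IsSimple {t : SubSuperalgebra g} {M : SuperModule g} (S : TSub t M) : Prop :=
  (S.S0 ≠ ⊥ ∨ S.S1 ≠ ⊥) ∧
  ∀ S' : TSub t M, S'.S0 ≤ S.S0 → S'.S1 ≤ S.S1 →
    (S'.S0 = ⊥ ∧ S'.S1 = ⊥) ∨ (S'.S0 = S.S0 ∧ S'.S1 = S.S1)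

/-- A `g`-supermodule `M` is finitely semisimple over the subsuperalgebra `t` if it is
a direct sum of finite-dimensional simple `t`-subsupermodules. -/
def FinSSOver (t : SubSuperalgebra g) (M : SuperModule g) : Prop :=
  ∃ (ι : Type) (S : ι → TSub t M),
    (∀ i, FiniteDimensional ℂ (S i).S0 ∧ FiniteDimensional ℂ (S i).S1) ∧
    (∀ i, (S i).IsSimple) ∧
    iSupIndep (fun i => (S i).S0) ∧ iSupIndep (fun i => (S i).S1) ∧
    (⨆ i, (S i).S0) = ⊤ ∧ (⨆ i, (S i).S1) = ⊤

end SubSuperalgebra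

/-- The adjoint supermodule: `g` acting on itself. -/
def LieSuperalgebra.adjoint (g : LieSuperalgebra) : SuperModule g where
  M0 := g.V0
  M1 := g.V1
  a00 := g.b00
  a01 := g.b01
  a10 := - g.b01.flip
  a11 := g.b11
  rel_00_0 := fun x y m => by
    rw [g.jacobi_000 x y m]; abel
  rel_00_1 := fun x y m => by
    rw [g.jacobi_001 x y m]; abel
  rel_01_0 := fun x u m => by
    have h := g.jacobi_001 x m u
    have h' : g.b01 m (g.b01 x u) = g.b01 x (g.b01 m u) - g.b01 (g.b00 x m) u := by
      rw [h]; abel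
    simp only [LinearMap.neg_apply, LinearMap.flip_apply, map_neg]
    rw [h']; abel
  rel_01_1 := fun x u m => by
    rw [g.jacobi_011 x u m]; abel
  rel_11_0 := fun u v m => by
    simp only [LinearMap.neg_apply, LinearMap.flip_apply, map_neg]
    rw [g.b00_skew (g.b11 u v) m, g.jacobi_011 m u v, g.b11_symm (g.b01 m u) v]
    abel
  rel_11_1 := fun u v m => by
    have h := g.jacobi_111 u v m
    rw [g.b11_symm m u] at h
    simp only [LinearMap.neg_apply, LinearMap.flip_apply]
    have hA : g.b01 (g.b11 u v) m
        = g.b01 (g.b11 u v) m + g.b01 (g.b11 v m) u + g.b01 (g.b11 u m) v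
          - g.b01 (g.b11 v m) u - g.b01 (g.b11 u m) v := by abel
    rw [hA, h]; abel

/-- `g` is finitely semisimple as a `t`-supermodule under the adjoint action. -/
def LieSuperalgebra.AdjFinSS (g : LieSuperalgebra) (t : SubSuperalgebra g) : Prop :=
  SubSuperalgebra.FinSSOver t g.adjoint
/-! Relative homological algebra for a pair `t ⊆ g`.  Since the category of
`g`-supermodules is the category of `U(g)`-supermodules, `(U(g),U(t))`-relative
notions (split exactness, relative projectivity, relative Ext) are formulated
directly at the level of supermodules. -/

namespace RelHom

variable {g : LieSuperalgebra}

/-- `f : M → N` is `t`-equivariant (an even morphism of `t`-supermodules). -/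
def IsTHom (t : SubSuperalgebra g) (M N : SuperModule g)
    (f : (M.M0 →ₗ[ℂ] N.M0) × (M.M1 →ₗ[ℂ] N.M1)) : Prop :=
  (∀ z ∈ t.t0, ∀ m, f.1 (M.a00 z m) = N.a00 z (f.1 m)) ∧
  (∀ z ∈ t.t0, ∀ m, f.2 (M.a01 z m) = N.a01 z (f.2 m)) ∧
  (∀ z ∈ t.t1, ∀ m, f.2 (M.a10 z m) = N.a10 z (f.1 m)) ∧
  (∀ z ∈ t.t1, ∀ m, f.1 (M.a11 z m) = N.a11 z (f.2 m))

/-- An even surjection of `g`-supermodules admitting a `t`-equivariant section,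
i.e. the associated short exact sequence is `(U(g),U(t))`-exact. -/
def RelSplitSurj (t : SubSuperalgebra g) (M N : SuperModule g)
    (f : (M.M0 →ₗ[ℂ] N.M0) × (M.M1 →ₗ[ℂ] N.M1)) : Prop :=
  SuperModule.IsHom M N f ∧
  ∃ s : (N.M0 →ₗ[ℂ] M.M0) × (N.M1 →ₗ[ℂ] M.M1),
    IsTHom t N M s ∧ (∀ n, f.1 (s.1 n) = n) ∧ (∀ n, f.2 (s.2 n) = n)

/-- `P` is `(U(g),U(t))`-relatively projective: every morphism from `P` lifts through
any relatively split surjection. -/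
def IsRelProjective (t : SubSuperalgebra g) (P : SuperModule g) : Prop :=
  ∀ (M N : SuperModule g) f, RelSplitSurj t M N f →
    ∀ h, SuperModule.IsHom P N h →
      ∃ h', SuperModule.IsHom P M h' ∧
        (∀ m, f.1 (h'.1 m) = h.1 m) ∧ (∀ m, f.2 (h'.2 m) = h.2 m)

/-- An exact resolution `⋯ → P₁ → P₀ → M → 0` of a `g`-supermodule `M` by
`g`-supermodules. -/
structure SMResolution (M : SuperModule g) : Type 1 where
  P : ℕ → SuperModule g
  d : ∀ p, ((P (p+1)).M0 →ₗ[ℂ] (P p).M0) × ((P (p+1)).M1 →ₗ[ℂ] (P p).M1)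
  hd : ∀ p, SuperModule.IsHom (P (p+1)) (P p) (d p)
  eps : ((P 0).M0 →ₗ[ℂ] M.M0) × ((P 0).M1 →ₗ[ℂ] M.M1)
  heps : SuperModule.IsHom (P 0) M eps
  exact0a : LinearMap.range eps.1 = ⊤
  exact0b : LinearMap.range eps.2 = ⊤
  exact1a : LinearMap.range (d 0).1 = LinearMap.ker eps.1
  exact1b : LinearMap.range (d 0).2 = LinearMap.ker eps.2
  exacta : ∀ p, LinearMap.range (d (p+1)).1 = LinearMap.ker (d p).1
  exactb : ∀ p, LinearMap.range (d (p+1)).2 = LinearMap.ker (d p).2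

/-- The resolution is `(U(g),U(t))`-exact and by relatively projective supermodules:
a `(U(g),U(t))`-relative projective resolution.  `(U(g),U(t))`-exactness means each
kernel is a direct summand as a `t`-supermodule. -/
structure IsRelProjRes (t : SubSuperalgebra g) {M : SuperModule g}
    (R : SMResolution M) : Prop where
  projective : ∀ p, IsRelProjective t (R.P p)
  split0 : ∃ C : SubSuperalgebra.TSub t (R.P 0),
    IsCompl (LinearMap.ker R.eps.1) C.S0 ∧ IsCompl (LinearMap.ker R.eps.2) C.S1
  splits : ∀ p, ∃ C : SubSuperalgebra.TSub t (R.P (p+1)),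
    IsCompl (LinearMap.ker (R.d p).1) C.S0 ∧ IsCompl (LinearMap.ker (R.d p).2) C.S1

/-- Composition of a morphism with a morphism. -/
lemma IsHom.comp {A B C : SuperModule g}
    {q : (A.M0 →ₗ[ℂ] B.M0) × (A.M1 →ₗ[ℂ] B.M1)}
    {f : (B.M0 →ₗ[ℂ] C.M0) × (B.M1 →ₗ[ℂ] C.M1)}
    (hq : SuperModule.IsHom A B q) (hf : SuperModule.IsHom B C f) :
    SuperModule.IsHom A C (f.1.comp q.1, f.2.comp q.2) := by
  obtain ⟨q1, q2, q3, q4⟩ := hq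
  obtain ⟨f1, f2, f3, f4⟩ := hf
  exact ⟨fun x m => by simp [q1, f1], fun x m => by simp [q2, f2],
    fun u m => by simp [q3, f3], fun u m => by simp [q4, f4]⟩

variable {M : SuperModule g}

/-- The map `Hom_g(P_p, N) → Hom_g(P_{p+1}, N)` of the complex computing Ext. -/
def extDiff (R : SMResolution M) (N : SuperModule g) (p : ℕ) :
    ↥(SuperModule.HomS (R.P p) N) →ₗ[ℂ] ↥(SuperModule.HomS (R.P (p+1)) N) :=
  LinearMap.restrict
    ((LinearMap.lcomp ℂ N.M0 (R.d p).1).prodMap (LinearMap.lcomp ℂ N.M1 (R.d p).2))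
    (fun _f hf => IsHom.comp (R.hd p) hf)

/-- Coboundaries for the Ext complex. -/
def extCobound (R : SMResolution M) (N : SuperModule g) :
    ∀ p, Submodule ℂ ↥(SuperModule.HomS (R.P p) N)
  | 0 => ⊥
  | (q+1) => LinearMap.range (extDiff R N q)

/-- Cocycles modulo coboundaries. -/
def Subquot {X Y : Type} [AddCommGroup X] [Module ℂ X] [AddCommGroup Y] [Module ℂ Y]
    (f : X →ₗ[ℂ] Y) (B : Submodule ℂ X) : Type :=
  ↥(LinearMap.ker f) ⧸ (Submodule.comap (LinearMap.ker f).subtype B)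

instance {X Y : Type} [AddCommGroup X] [Module ℂ X] [AddCommGroup Y] [Module ℂ Y]
    (f : X →ₗ[ℂ] Y) (B : Submodule ℂ X) : AddCommGroup (Subquot f B) :=
  inferInstanceAs (AddCommGroup (_ ⧸ _))

instance {X Y : Type} [AddCommGroup X] [Module ℂ X] [AddCommGroup Y] [Module ℂ Y]
    (f : X →ₗ[ℂ] Y) (B : Submodule ℂ X) : Module ℂ (Subquot f B) :=
  inferInstanceAs (Module ℂ (_ ⧸ _))

/-- `Ext^p(M,N)` computed from the resolution `R`; applied to a
`(U(g),U(t))`-relative projective resolution this is `Ext^p_{(U(g),U(t))}(M,N)`. -/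
def relExt (R : SMResolution M) (N : SuperModule g) (p : ℕ) : Type :=
  Subquot (extDiff R N p) (extCobound R N p)

instance (R : SMResolution M) (N : SuperModule g) (p : ℕ) :
    AddCommGroup (relExt R N p) :=
  inferInstanceAs (AddCommGroup (Subquot (extDiff R N p) (extCobound R N p)))

instance (R : SMResolution M) (N : SuperModule g) (p : ℕ) :
    Module ℂ (relExt R N p) :=
  inferInstanceAs (Module ℂ (Subquot (extDiff R N p) (extCobound R N p)))

end RelHom
/-! Subsuperalgebras as Lie superalgebras, restriction of supermodules, and
induced supermodules `U(g) ⊗_{U(t)} L` characterized by their universal property. -/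

namespace SubSuperalgebra

variable {g : LieSuperalgebra}

/-- A subsuperalgebra, viewed as a Lie superalgebra in its own right. -/
def toLie (t : SubSuperalgebra g) : LieSuperalgebra where
  V0 := ↥t.t0
  V1 := ↥t.t1
  b00 := LinearMap.mk₂ ℂ (fun x y => ⟨g.b00 x y, t.closed00 x x.2 y y.2⟩)
    (fun x x' y => Subtype.ext (by simp))
    (fun c x y => Subtype.ext (by simp))
    (fun x y y' => Subtype.ext (by simp))
    (fun c x y => Subtype.ext (by simp))
  b01 := LinearMap.mk₂ ℂ (fun x u => ⟨g.b01 x u, t.closed01 x x.2 u u.2⟩)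
    (fun x x' y => Subtype.ext (by simp))
    (fun c x y => Subtype.ext (by simp))
    (fun x y y' => Subtype.ext (by simp))
    (fun c x y => Subtype.ext (by simp))
  b11 := LinearMap.mk₂ ℂ (fun u v => ⟨g.b11 u v, t.closed11 u u.2 v v.2⟩)
    (fun x x' y => Subtype.ext (by simp))
    (fun c x y => Subtype.ext (by simp))
    (fun x y y' => Subtype.ext (by simp))
    (fun c x y => Subtype.ext (by simp))
  b00_skew := fun x y => Subtype.ext (by simp [g.b00_skew x.1 y.1])
  b11_symm := fun u v => Subtype.ext (by simp [g.b11_symm u.1 v.1])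
  jacobi_000 := fun x y z => Subtype.ext (by simp [g.jacobi_000 x.1 y.1 z.1])
  jacobi_001 := fun x y u => Subtype.ext (by simp [g.jacobi_001 x.1 y.1 u.1])
  jacobi_011 := fun x u v => Subtype.ext (by simp [g.jacobi_011 x.1 u.1 v.1])
  jacobi_111 := fun u v w => Subtype.ext (by simp [g.jacobi_111 u.1 v.1 w.1])

end SubSuperalgebra

namespace SuperModule

variable {g : LieSuperalgebra}

/-- Restriction of a `g`-supermodule to a subsuperalgebra `t ⊆ g`. -/
def restrict (t : SubSuperalgebra g) (M : SuperModule g) : SuperModule t.toLie where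
  M0 := M.M0
  M1 := M.M1
  a00 := M.a00.comp t.t0.subtype
  a01 := M.a01.comp t.t0.subtype
  a10 := M.a10.comp t.t1.subtype
  a11 := M.a11.comp t.t1.subtype
  rel_00_0 := fun x y m => M.rel_00_0 x.1 y.1 m
  rel_00_1 := fun x y m => M.rel_00_1 x.1 y.1 m
  rel_01_0 := fun x u m => M.rel_01_0 x.1 u.1 m
  rel_01_1 := fun x u m => M.rel_01_1 x.1 u.1 m
  rel_11_0 := fun u v m => M.rel_11_0 u.1 v.1 m
  rel_11_1 := fun u v m => M.rel_11_1 u.1 v.1 m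

/-- The full subsuperalgebra `g ⊆ g`. -/
def _root_.SubSuperalgebra.full (a : LieSuperalgebra) : SubSuperalgebra a where
  t0 := ⊤
  t1 := ⊤
  closed00 := fun _ _ _ _ => Submodule.mem_top
  closed01 := fun _ _ _ _ => Submodule.mem_top
  closed11 := fun _ _ _ _ => Submodule.mem_top

/-- A supermodule is simple if it is nonzero and has no nonzero proper
subsupermodules. -/
def IsSimpleSM {a : LieSuperalgebra} (M : SuperModule a) : Prop :=
  ((∃ m : M.M0, m ≠ 0) ∨ (∃ m : M.M1, m ≠ 0)) ∧
  ∀ S : SubSuperalgebra.TSub (SubSuperalgebra.full a) M,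
    (S.S0 = ⊥ ∧ S.S1 = ⊥) ∨ (S.S0 = ⊤ ∧ S.S1 = ⊤)

/-- `X` is (isomorphic to) the induced supermodule `U(g) ⊗_{U(t)} L`:  it receives a
morphism of `t`-supermodules from `L` which is universal among morphisms of
`t`-supermodules from `L` to restrictions of `g`-supermodules (Frobenius
reciprocity). -/
def IsInducedFrom (t : SubSuperalgebra g) (L : SuperModule t.toLie)
    (X : SuperModule g) : Prop :=
  ∃ j : (L.M0 →ₗ[ℂ] X.M0) × (L.M1 →ₗ[ℂ] X.M1),
    IsHom L (X.restrict t) j ∧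
    ∀ (Y : SuperModule g) (f : (L.M0 →ₗ[ℂ] Y.M0) × (L.M1 →ₗ[ℂ] Y.M1)),
      IsHom L (Y.restrict t) f →
      ∃! F : (X.M0 →ₗ[ℂ] Y.M0) × (X.M1 →ₗ[ℂ] Y.M1),
        IsHom X Y F ∧ F.1.comp j.1 = f.1 ∧ F.2.comp j.2 = f.2

/-- `P` is a projective object of the category `𝒞_{(g,t)}` of `g`-supermodules which
are finitely semisimple over `t`. -/
def IsProjectiveInC (t : SubSuperalgebra g) (P : SuperModule g) : Prop :=
  SubSuperalgebra.FinSSOver t P ∧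
  ∀ (M N : SuperModule g), SubSuperalgebra.FinSSOver t M → SubSuperalgebra.FinSSOver t N →
    ∀ f, IsHom M N f → Function.Surjective f.1 → Function.Surjective f.2 →
      ∀ h, IsHom P N h →
        ∃ h', IsHom P M h' ∧
          (∀ m, f.1 (h'.1 m) = h.1 m) ∧ (∀ m, f.2 (h'.2 m) = h.2 m)

end SuperModule
namespace SubSuperalgebra

variable {g : LieSuperalgebra}

/-- A `t`-invariant subsupermodule of a `g`-supermodule, viewed as a supermodule over
the subsuperalgebra `t`. -/
def TSub.toSuperModule {t : SubSuperalgebra g} {M : SuperModule g} (S : TSub t M) :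
    SuperModule t.toLie where
  M0 := ↥S.S0
  M1 := ↥S.S1
  a00 := LinearMap.mk₂ ℂ
    (fun (z : ↥t.t0) (m : ↥S.S0) => (⟨M.a00 z.1 m.1, S.inv00 z.1 z.2 m.1 m.2⟩ : ↥S.S0))
    (fun x x' y => Subtype.ext (by
      show (M.a00 (Subtype.val x + Subtype.val x')) (Subtype.val y) = _; simp))
    (fun c x y => Subtype.ext (by
      show (M.a00 (c • Subtype.val x)) (Subtype.val y) = _; simp))
    (fun x y y' => Subtype.ext (by simp)) (fun c x y => Subtype.ext (by simp))
  a01 := LinearMap.mk₂ ℂ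
    (fun (z : ↥t.t0) (m : ↥S.S1) => (⟨M.a01 z.1 m.1, S.inv01 z.1 z.2 m.1 m.2⟩ : ↥S.S1))
    (fun x x' y => Subtype.ext (by
      show (M.a01 (Subtype.val x + Subtype.val x')) (Subtype.val y) = _; simp))
    (fun c x y => Subtype.ext (by
      show (M.a01 (c • Subtype.val x)) (Subtype.val y) = _; simp))
    (fun x y y' => Subtype.ext (by simp)) (fun c x y => Subtype.ext (by simp))
  a10 := LinearMap.mk₂ ℂ
    (fun (z : ↥t.t1) (m : ↥S.S0) => (⟨M.a10 z.1 m.1, S.inv10 z.1 z.2 m.1 m.2⟩ : ↥S.S1))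
    (fun x x' y => Subtype.ext (by
      show (M.a10 (Subtype.val x + Subtype.val x')) (Subtype.val y) = _; simp))
    (fun c x y => Subtype.ext (by
      show (M.a10 (c • Subtype.val x)) (Subtype.val y) = _; simp))
    (fun x y y' => Subtype.ext (by simp)) (fun c x y => Subtype.ext (by simp))
  a11 := LinearMap.mk₂ ℂ
    (fun (z : ↥t.t1) (m : ↥S.S1) => (⟨M.a11 z.1 m.1, S.inv11 z.1 z.2 m.1 m.2⟩ : ↥S.S0))
    (fun x x' y => Subtype.ext (by
      show (M.a11 (Subtype.val x + Subtype.val x')) (Subtype.val y) = _; simp))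
    (fun c x y => Subtype.ext (by
      show (M.a11 (c • Subtype.val x)) (Subtype.val y) = _; simp))
    (fun x y y' => Subtype.ext (by simp)) (fun c x y => Subtype.ext (by simp))
  rel_00_0 := fun x y m => Subtype.ext (M.rel_00_0 x.1 y.1 m.1)
  rel_00_1 := fun x y m => Subtype.ext (M.rel_00_1 x.1 y.1 m.1)
  rel_01_0 := fun x u m => Subtype.ext (M.rel_01_0 x.1 u.1 m.1)
  rel_01_1 := fun x u m => Subtype.ext (M.rel_01_1 x.1 u.1 m.1)
  rel_11_0 := fun u v m => Subtype.ext (M.rel_11_0 u.1 v.1 m.1)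
  rel_11_1 := fun u v m => Subtype.ext (M.rel_11_1 u.1 v.1 m.1)

end SubSuperalgebra

namespace SuperModule

variable {g : LieSuperalgebra}

/-- `X` is the direct sum of the family `Mi` of `g`-supermodules. -/
def IsDirectSumOf (X : SuperModule g) {ι : Type} (Mi : ι → SuperModule g) : Prop :=
  ∃ j : ∀ i, ((Mi i).M0 →ₗ[ℂ] X.M0) × ((Mi i).M1 →ₗ[ℂ] X.M1),
    (∀ i, IsHom (Mi i) X (j i)) ∧
    (∀ i, Function.Injective (j i).1 ∧ Function.Injective (j i).2) ∧
    iSupIndep (fun i => LinearMap.range (j i).1) ∧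
    iSupIndep (fun i => LinearMap.range (j i).2) ∧
    (⨆ i, LinearMap.range (j i).1) = ⊤ ∧ (⨆ i, LinearMap.range (j i).2) = ⊤

end SuperModule

/-- `P` is a projective object of the full subcategory given by the class of objects
`D`: every morphism from `P` to an object of `D` lifts through any epimorphism
between objects of `D`. -/
def SuperModule.IsProjectiveInD {g : LieSuperalgebra} (D : SuperModule g → Prop)
    (P : SuperModule g) : Prop :=
  ∀ (M N : SuperModule g), D M → D N →
    ∀ f, SuperModule.IsHom M N f → Function.Surjective f.1 → Function.Surjective f.2 →
      ∀ h, SuperModule.IsHom P N h →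
        ∃ h', SuperModule.IsHom P M h' ∧
          (∀ m, f.1 (h'.1 m) = h.1 m) ∧ (∀ m, f.2 (h'.2 m) = h.2 m)

/-- A resolution of `M` by projective objects of the full subcategory given by the
class of objects `D`, used to compute `Ext_D`. -/
def RelHom.IsProjResInD {g : LieSuperalgebra} (D : SuperModule g → Prop)
    {M : SuperModule g} (R : RelHom.SMResolution M) : Prop :=
  ∀ p, D (R.P p) ∧ SuperModule.IsProjectiveInD D (R.P p)

/-! ## Statement 2 -/

namespace SuperModule

variable {g : LieSuperalgebra} (t : SubSuperalgebra g)

section Induced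

variable (L : SuperModule t.toLie)

/-- Formal words in elements of `g` applied to an element of `L`, graded by parity
(`false` for even words, `true` for odd words). -/
inductive IndWord : Bool → Type
  | of0 : L.M0 → IndWord false
  | of1 : L.M1 → IndWord true
  | a00 : g.V0 → IndWord false → IndWord false
  | a01 : g.V0 → IndWord true → IndWord true
  | a10 : g.V1 → IndWord false → IndWord true
  | a11 : g.V1 → IndWord true → IndWord false

/-- A `g`-supermodule together with a morphism of `t`-supermodules from `L`. -/
structure IndTarget : Type 1 where
  Y : SuperModule g
  f : (L.M0 →ₗ[ℂ] Y.M0) × (L.M1 →ₗ[ℂ] Y.M1)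
  hf : IsHom L (Y.restrict t) f

/-- The even or odd part of a supermodule. -/
def part (Y : SuperModule g) : Bool → Type
  | false => Y.M0
  | true => Y.M1

variable {t L}

/-- The value of a word in a `g`-supermodule receiving a morphism from `L`. -/
def IndTarget.evalWord (T : IndTarget t L) : ∀ {b}, IndWord t L b → T.Y.part b
  | _, .of0 l => T.f.1 l
  | _, .of1 l => T.f.2 l
  | _, .a00 x w => T.Y.a00 x (T.evalWord w)
  | _, .a01 x w => T.Y.a01 x (T.evalWord w)
  | _, .a10 u w => T.Y.a10 u (T.evalWord w)
  | _, .a11 u w => T.Y.a11 u (T.evalWord w)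

/-- `evalWord` on even words. -/
def IndTarget.evalWord0 (T : IndTarget t L) (w : IndWord t L false) : T.Y.M0 :=
  T.evalWord w

/-- `evalWord` on odd words. -/
def IndTarget.evalWord1 (T : IndTarget t L) (w : IndWord t L true) : T.Y.M1 :=
  T.evalWord w

@[simp]
lemma IndTarget.evalWord0_a00 (T : IndTarget t L) (x : g.V0) (w : IndWord t L false) :
    T.evalWord0 (.a00 x w) = T.Y.a00 x (T.evalWord0 w) := rfl

@[simp]
lemma IndTarget.evalWord1_a01 (T : IndTarget t L) (x : g.V0) (w : IndWord t L true) :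
    T.evalWord1 (.a01 x w) = T.Y.a01 x (T.evalWord1 w) := rfl

@[simp]
lemma IndTarget.evalWord1_a10 (T : IndTarget t L) (u : g.V1) (w : IndWord t L false) :
    T.evalWord1 (.a10 u w) = T.Y.a10 u (T.evalWord0 w) := rfl

@[simp]
lemma IndTarget.evalWord0_a11 (T : IndTarget t L) (u : g.V1) (w : IndWord t L true) :
    T.evalWord0 (.a11 u w) = T.Y.a11 u (T.evalWord1 w) := rfl

/-- The linear extension of `evalWord0` to combinations of even words. -/
def IndTarget.eval0 (T : IndTarget t L) : (IndWord t L false →₀ ℂ) →ₗ[ℂ] T.Y.M0 :=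
  Finsupp.linearCombination ℂ T.evalWord0

/-- The linear extension of `evalWord1` to combinations of odd words. -/
def IndTarget.eval1 (T : IndTarget t L) : (IndWord t L true →₀ ℂ) →ₗ[ℂ] T.Y.M1 :=
  Finsupp.linearCombination ℂ T.evalWord1

lemma IndTarget.eval0_a00 (T : IndTarget t L) (x : g.V0) :
    T.eval0 ∘ₗ Finsupp.lmapDomain ℂ ℂ (IndWord.a00 x) = T.Y.a00 x ∘ₗ T.eval0 := by
  ext w
  simp [eval0]

lemma IndTarget.eval1_a01 (T : IndTarget t L) (x : g.V0) :
    T.eval1 ∘ₗ Finsupp.lmapDomain ℂ ℂ (IndWord.a01 x) = T.Y.a01 x ∘ₗ T.eval1 := by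
  ext w
  simp [eval1]

lemma IndTarget.eval1_a10 (T : IndTarget t L) (u : g.V1) :
    T.eval1 ∘ₗ Finsupp.lmapDomain ℂ ℂ (IndWord.a10 u) = T.Y.a10 u ∘ₗ T.eval0 := by
  ext w
  simp [eval0, eval1]

lemma IndTarget.eval0_a11 (T : IndTarget t L) (u : g.V1) :
    T.eval0 ∘ₗ Finsupp.lmapDomain ℂ ℂ (IndWord.a11 u) = T.Y.a11 u ∘ₗ T.eval1 := by
  ext w
  simp [eval0, eval1]

variable (t L)

/-- Combinations of even words which vanish in every target. -/
def indKer0 : Submodule ℂ (IndWord t L false →₀ ℂ) :=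
  ⨅ T : IndTarget t L, LinearMap.ker T.eval0

/-- Combinations of odd words which vanish in every target. -/
def indKer1 : Submodule ℂ (IndWord t L true →₀ ℂ) :=
  ⨅ T : IndTarget t L, LinearMap.ker T.eval1

/-- The even part of the induced supermodule. -/
abbrev Ind0 : Type := (IndWord t L false →₀ ℂ) ⧸ indKer0 t L

/-- The odd part of the induced supermodule. -/
abbrev Ind1 : Type := (IndWord t L true →₀ ℂ) ⧸ indKer1 t L

variable {t L}

/-- The even component of the morphism out of the induced supermodule. -/
def IndTarget.lift0 (T : IndTarget t L) :
    Ind0 t L →ₗ[ℂ] T.Y.M0 :=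
  (indKer0 t L).liftQ T.eval0 (iInf_le _ T)

/-- The odd component of the morphism out of the induced supermodule. -/
def IndTarget.lift1 (T : IndTarget t L) :
    Ind1 t L →ₗ[ℂ] T.Y.M1 :=
  (indKer1 t L).liftQ T.eval1 (iInf_le _ T)

lemma ind_ext0 {q q' : Ind0 t L}
    (h : ∀ T : IndTarget t L, T.lift0 q = T.lift0 q') : q = q' := by
  induction q using Submodule.Quotient.induction_on with | _ v
  induction q' using Submodule.Quotient.induction_on with | _ v'
  rw [Submodule.Quotient.eq, indKer0, Submodule.mem_iInf]
  intro T
  rw [LinearMap.mem_ker, map_sub, sub_eq_zero]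
  exact h T

lemma ind_ext1 {q q' : Ind1 t L}
    (h : ∀ T : IndTarget t L, T.lift1 q = T.lift1 q') : q = q' := by
  induction q using Submodule.Quotient.induction_on with | _ v
  induction q' using Submodule.Quotient.induction_on with | _ v'
  rw [Submodule.Quotient.eq, indKer1, Submodule.mem_iInf]
  intro T
  rw [LinearMap.mem_ker, map_sub, sub_eq_zero]
  exact h T

/-- The action of an even element on the even part of the induced supermodule. -/
def indOp00 (x : g.V0) : Ind0 t L →ₗ[ℂ] Ind0 t L :=
  (indKer0 t L).mapQ _ (Finsupp.lmapDomain ℂ ℂ (IndWord.a00 x)) fun v hv => by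
    simp only [indKer0, Submodule.mem_iInf, Submodule.mem_comap, LinearMap.mem_ker] at hv ⊢
    intro T
    rw [← LinearMap.comp_apply, T.eval0_a00, LinearMap.comp_apply, hv, map_zero]

/-- The action of an even element on the odd part of the induced supermodule. -/
def indOp01 (x : g.V0) : Ind1 t L →ₗ[ℂ] Ind1 t L :=
  (indKer1 t L).mapQ _ (Finsupp.lmapDomain ℂ ℂ (IndWord.a01 x)) fun v hv => by
    simp only [indKer1, Submodule.mem_iInf, Submodule.mem_comap, LinearMap.mem_ker] at hv ⊢
    intro T
    rw [← LinearMap.comp_apply, T.eval1_a01, LinearMap.comp_apply, hv, map_zero]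

/-- The action of an odd element on the even part of the induced supermodule. -/
def indOp10 (u : g.V1) : Ind0 t L →ₗ[ℂ] Ind1 t L :=
  (indKer0 t L).mapQ _ (Finsupp.lmapDomain ℂ ℂ (IndWord.a10 u)) fun v hv => by
    simp only [indKer0, indKer1, Submodule.mem_iInf, Submodule.mem_comap,
      LinearMap.mem_ker] at hv ⊢
    intro T
    rw [← LinearMap.comp_apply, T.eval1_a10, LinearMap.comp_apply, hv, map_zero]

/-- The action of an odd element on the odd part of the induced supermodule. -/
def indOp11 (u : g.V1) : Ind1 t L →ₗ[ℂ] Ind0 t L :=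
  (indKer1 t L).mapQ _ (Finsupp.lmapDomain ℂ ℂ (IndWord.a11 u)) fun v hv => by
    simp only [indKer0, indKer1, Submodule.mem_iInf, Submodule.mem_comap,
      LinearMap.mem_ker] at hv ⊢
    intro T
    rw [← LinearMap.comp_apply, T.eval0_a11, LinearMap.comp_apply, hv, map_zero]

@[simp]
lemma IndTarget.lift0_indOp00 (T : IndTarget t L) (x : g.V0)
    (q : Ind0 t L) :
    T.lift0 (indOp00 x q) = T.Y.a00 x (T.lift0 q) := by
  induction q using Submodule.Quotient.induction_on with | _ v
  exact DFunLike.congr_fun (T.eval0_a00 x) v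

@[simp]
lemma IndTarget.lift1_indOp01 (T : IndTarget t L) (x : g.V0)
    (q : Ind1 t L) :
    T.lift1 (indOp01 x q) = T.Y.a01 x (T.lift1 q) := by
  induction q using Submodule.Quotient.induction_on with | _ v
  exact DFunLike.congr_fun (T.eval1_a01 x) v

@[simp]
lemma IndTarget.lift1_indOp10 (T : IndTarget t L) (u : g.V1)
    (q : Ind0 t L) :
    T.lift1 (indOp10 u q) = T.Y.a10 u (T.lift0 q) := by
  induction q using Submodule.Quotient.induction_on with | _ v
  exact DFunLike.congr_fun (T.eval1_a10 u) v

@[simp]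
lemma IndTarget.lift0_indOp11 (T : IndTarget t L) (u : g.V1)
    (q : Ind1 t L) :
    T.lift0 (indOp11 u q) = T.Y.a11 u (T.lift1 q) := by
  induction q using Submodule.Quotient.induction_on with | _ v
  exact DFunLike.congr_fun (T.eval0_a11 u) v

variable (t L)

/-- The induced supermodule `U(g) ⊗_{U(t)} L`: combinations of words modulo those which
vanish in every target. -/
def induced : SuperModule g where
  M0 := Ind0 t L
  M1 := Ind1 t L
  a00 := LinearMap.mk₂ ℂ (fun x q => indOp00 x q)
    (fun _ _ _ => ind_ext0 fun T => by simp) (fun _ _ _ => ind_ext0 fun T => by simp)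
    (fun _ _ _ => map_add _ _ _) (fun _ _ _ => map_smul _ _ _)
  a01 := LinearMap.mk₂ ℂ (fun x q => indOp01 x q)
    (fun _ _ _ => ind_ext1 fun T => by simp) (fun _ _ _ => ind_ext1 fun T => by simp)
    (fun _ _ _ => map_add _ _ _) (fun _ _ _ => map_smul _ _ _)
  a10 := LinearMap.mk₂ ℂ (fun u q => indOp10 u q)
    (fun _ _ _ => ind_ext1 fun T => by simp) (fun _ _ _ => ind_ext1 fun T => by simp)
    (fun _ _ _ => map_add _ _ _) (fun _ _ _ => map_smul _ _ _)
  a11 := LinearMap.mk₂ ℂ (fun u q => indOp11 u q)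
    (fun _ _ _ => ind_ext0 fun T => by simp) (fun _ _ _ => ind_ext0 fun T => by simp)
    (fun _ _ _ => map_add _ _ _) (fun _ _ _ => map_smul _ _ _)
  rel_00_0 := fun _ _ _ => ind_ext0 fun T => by simp [T.Y.rel_00_0]
  rel_00_1 := fun _ _ _ => ind_ext1 fun T => by simp [T.Y.rel_00_1]
  rel_01_0 := fun _ _ _ => ind_ext1 fun T => by simp [T.Y.rel_01_0]
  rel_01_1 := fun _ _ _ => ind_ext0 fun T => by simp [T.Y.rel_01_1]
  rel_11_0 := fun _ _ _ => ind_ext0 fun T => by simp [T.Y.rel_11_0]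
  rel_11_1 := fun _ _ _ => ind_ext1 fun T => by simp [T.Y.rel_11_1]

variable {t L}

lemma IndTarget.isHom_lift (T : IndTarget t L) :
    IsHom (induced t L) T.Y (T.lift0, T.lift1) :=
  ⟨T.lift0_indOp00, T.lift1_indOp01, T.lift1_indOp10, T.lift0_indOp11⟩

/-- The class of an even word in the induced supermodule. -/
def indMk0 (w : IndWord t L false) : Ind0 t L :=
  (indKer0 t L).mkQ (Finsupp.single w 1)

/-- The class of an odd word in the induced supermodule. -/
def indMk1 (w : IndWord t L true) : Ind1 t L :=
  (indKer1 t L).mkQ (Finsupp.single w 1)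

@[simp]
lemma IndTarget.lift0_indMk0 (T : IndTarget t L) (w : IndWord t L false) :
    T.lift0 (indMk0 w) = T.evalWord0 w := by
  simp [indMk0, lift0, eval0]

@[simp]
lemma IndTarget.lift1_indMk1 (T : IndTarget t L) (w : IndWord t L true) :
    T.lift1 (indMk1 w) = T.evalWord1 w := by
  simp [indMk1, lift1, eval1]

lemma indMk0_a00 (x : g.V0) (w : IndWord t L false) :
    indMk0 (.a00 x w) = indOp00 x (indMk0 w) :=
  ind_ext0 fun T => by simp

lemma indMk1_a01 (x : g.V0) (w : IndWord t L true) :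
    indMk1 (.a01 x w) = indOp01 x (indMk1 w) :=
  ind_ext1 fun T => by simp

lemma indMk1_a10 (u : g.V1) (w : IndWord t L false) :
    indMk1 (.a10 u w) = indOp10 u (indMk0 w) :=
  ind_ext1 fun T => by simp

lemma indMk0_a11 (u : g.V1) (w : IndWord t L true) :
    indMk0 (.a11 u w) = indOp11 u (indMk1 w) :=
  ind_ext0 fun T => by simp

variable (t L)

/-- The even component of the canonical map from `L` to the induced supermodule. -/
def indUnit0 : L.M0 →ₗ[ℂ] Ind0 t L where
  toFun l := indMk0 (.of0 l)
  map_add' l l' := ind_ext0 fun T => by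
    rw [map_add]
    simp only [T.lift0_indMk0]
    exact map_add T.f.1 l l'
  map_smul' c l := ind_ext0 fun T => by
    rw [map_smul]
    simp only [T.lift0_indMk0]
    exact map_smul T.f.1 c l

/-- The odd component of the canonical map from `L` to the induced supermodule. -/
def indUnit1 : L.M1 →ₗ[ℂ] Ind1 t L where
  toFun l := indMk1 (.of1 l)
  map_add' l l' := ind_ext1 fun T => by
    rw [map_add]
    simp only [T.lift1_indMk1]
    exact map_add T.f.2 l l'
  map_smul' c l := ind_ext1 fun T => by
    rw [map_smul]
    simp only [T.lift1_indMk1]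
    exact map_smul T.f.2 c l

/-- The canonical map from `L` to the induced supermodule. -/
def indUnit : (L.M0 →ₗ[ℂ] (induced t L).M0) × (L.M1 →ₗ[ℂ] (induced t L).M1) :=
  (indUnit0 t L, indUnit1 t L)

variable {t L}

lemma IndTarget.lift0_indUnit (T : IndTarget t L) (l : L.M0) :
    T.lift0 ((indUnit t L).1 l) = T.f.1 l :=
  T.lift0_indMk0 _

lemma IndTarget.lift1_indUnit (T : IndTarget t L) (l : L.M1) :
    T.lift1 ((indUnit t L).2 l) = T.f.2 l :=
  T.lift1_indMk1 _

variable (t L)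

lemma isHom_indUnit : IsHom L ((induced t L).restrict t) (indUnit t L) := by
  refine ⟨fun x m => ind_ext0 fun T => ?_, fun x m => ind_ext1 fun T => ?_,
    fun u m => ind_ext1 fun T => ?_, fun u m => ind_ext0 fun T => ?_⟩
  · exact (T.lift0_indUnit _).trans ((T.hf.1 x m).trans
      ((T.isHom_lift.1 x.1 _).trans (congrArg _ (T.lift0_indUnit m))).symm)
  · exact (T.lift1_indUnit _).trans ((T.hf.2.1 x m).trans
      ((T.isHom_lift.2.1 x.1 _).trans (congrArg _ (T.lift1_indUnit m))).symm)
  · exact (T.lift1_indUnit _).trans ((T.hf.2.2.1 u m).trans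
      ((T.isHom_lift.2.2.1 u.1 _).trans (congrArg _ (T.lift0_indUnit m))).symm)
  · exact (T.lift0_indUnit _).trans ((T.hf.2.2.2 u m).trans
      ((T.isHom_lift.2.2.2 u.1 _).trans (congrArg _ (T.lift1_indUnit m))).symm)

variable {t L}

/-- A morphism out of the induced supermodule takes on words the values prescribed by its
restriction to `L`. -/
lemma IndTarget.hom_indMk (T : IndTarget t L)
    {F : ((induced t L).M0 →ₗ[ℂ] T.Y.M0) × ((induced t L).M1 →ₗ[ℂ] T.Y.M1)}
    (hF : IsHom (induced t L) T.Y F) (h0 : F.1.comp (indUnit t L).1 = T.f.1)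
    (h1 : F.2.comp (indUnit t L).2 = T.f.2) {b : Bool} (w : IndWord t L b) :
    (∀ hb : b = false, F.1 (indMk0 (hb ▸ w)) = T.evalWord0 (hb ▸ w)) ∧
    (∀ hb : b = true, F.2 (indMk1 (hb ▸ w)) = T.evalWord1 (hb ▸ w)) := by
  induction w with
  | of0 l => exact ⟨fun _ => DFunLike.congr_fun h0 l, nofun⟩
  | of1 l => exact ⟨nofun, fun _ => DFunLike.congr_fun h1 l⟩
  | a00 x w ih =>
    exact ⟨fun _ => (congrArg F.1 (indMk0_a00 x w)).trans
      ((hF.1 x _).trans (congrArg (T.Y.a00 x) (ih.1 rfl))), nofun⟩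
  | a01 x w ih =>
    exact ⟨nofun, fun _ => (congrArg F.2 (indMk1_a01 x w)).trans
      ((hF.2.1 x _).trans (congrArg (T.Y.a01 x) (ih.2 rfl)))⟩
  | a10 u w ih =>
    exact ⟨nofun, fun _ => (congrArg F.2 (indMk1_a10 u w)).trans
      ((hF.2.2.1 u _).trans (congrArg (T.Y.a10 u) (ih.1 rfl)))⟩
  | a11 u w ih =>
    exact ⟨fun _ => (congrArg F.1 (indMk0_a11 u w)).trans
      ((hF.2.2.2 u _).trans (congrArg (T.Y.a11 u) (ih.2 rfl))), nofun⟩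

variable (t L)

theorem isInducedFrom_induced : IsInducedFrom t L (induced t L) := by
  refine ⟨indUnit t L, isHom_indUnit t L, fun Y f hf => ?_⟩
  let T : IndTarget t L := ⟨Y, f, hf⟩
  refine ⟨(T.lift0, T.lift1), ⟨T.isHom_lift, LinearMap.ext T.lift0_indUnit,
    LinearMap.ext T.lift1_indUnit⟩, ?_⟩
  rintro F ⟨hF, h0, h1⟩
  refine Prod.ext ?_ ?_
  · refine Submodule.linearMap_qext _ (Finsupp.lhom_ext' fun w => LinearMap.ext_ring ?_)
    exact ((T.hom_indMk hF h0 h1 w).1 rfl).trans (T.lift0_indMk0 w).symm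
  · refine Submodule.linearMap_qext _ (Finsupp.lhom_ext' fun w => LinearMap.ext_ring ?_)
    exact ((T.hom_indMk hF h0 h1 w).2 rfl).trans (T.lift1_indMk1 w).symm

end Induced

end SuperModule

namespace SubSuperalgebra

variable {g : LieSuperalgebra} {t : SubSuperalgebra g}

section Semisimple

variable (t) (M : SuperModule g)

/-- The algebra of endomorphisms of `M₀ × M₁` generated by the action of `t` and the
projections onto the graded pieces.  Its invariant subspaces are the `t`-invariant
subsupermodules of `M`. -/
def opAlgebra : Subalgebra ℂ (Module.End ℂ (M.M0 × M.M1)) :=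
  Algebra.adjoin ℂ
    ({LinearMap.inl ℂ M.M0 M.M1 ∘ₗ LinearMap.fst ℂ M.M0 M.M1,
      LinearMap.inr ℂ M.M0 M.M1 ∘ₗ LinearMap.snd ℂ M.M0 M.M1} ∪
    ((fun z => (M.a00 z).prodMap (M.a01 z)) '' t.t0 ∪
     (fun z => (M.a11 z ∘ₗ LinearMap.snd ℂ M.M0 M.M1).prod
      (M.a10 z ∘ₗ LinearMap.fst ℂ M.M0 M.M1)) '' t.t1))

variable {t M}

/-- A `t`-invariant subsupermodule as a submodule over `opAlgebra`. -/
def TSub.toSubmodule (S : TSub t M) : Submodule (opAlgebra t M) (M.M0 × M.M1) where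
  carrier := {m | m.1 ∈ S.S0 ∧ m.2 ∈ S.S1}
  add_mem' := fun ha hb => ⟨S.S0.add_mem ha.1 hb.1, S.S1.add_mem ha.2 hb.2⟩
  zero_mem' := ⟨S.S0.zero_mem, S.S1.zero_mem⟩
  smul_mem' := by
    have key : ∀ r ∈ opAlgebra t M, ∀ m : M.M0 × M.M1, m.1 ∈ S.S0 ∧ m.2 ∈ S.S1 →
        (r m).1 ∈ S.S0 ∧ (r m).2 ∈ S.S1 := by
      intro r hr
      rw [opAlgebra] at hr
      induction hr using Algebra.adjoin_induction with
      | mem r hr =>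
        intro m hm
        obtain (rfl | rfl) | ⟨z, hz, rfl⟩ | ⟨z, hz, rfl⟩ := hr
        · exact ⟨hm.1, S.S1.zero_mem⟩
        · exact ⟨S.S0.zero_mem, hm.2⟩
        · exact ⟨S.inv00 z hz _ hm.1, S.inv01 z hz _ hm.2⟩
        · exact ⟨S.inv11 z hz _ hm.2, S.inv10 z hz _ hm.1⟩
      | algebraMap c => exact fun m hm => ⟨S.S0.smul_mem c hm.1, S.S1.smul_mem c hm.2⟩
      | add r r' _ _ h h' =>
        exact fun m hm =>
          ⟨S.S0.add_mem (h m hm).1 (h' m hm).1, S.S1.add_mem (h m hm).2 (h' m hm).2⟩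
      | mul r r' _ _ h h' => exact fun m hm => h _ (h' m hm)
    exact fun r m hm => key r.1 r.2 m hm

lemma TSub.mem_toSubmodule (S : TSub t M) (m : M.M0 × M.M1) :
    m ∈ S.toSubmodule ↔ m.1 ∈ S.S0 ∧ m.2 ∈ S.S1 := Iff.rfl

lemma apply_mem_of_mem_opAlgebra (W : Submodule (opAlgebra t M) (M.M0 × M.M1))
    {r : Module.End ℂ (M.M0 × M.M1)} (hr : r ∈ opAlgebra t M) {m : M.M0 × M.M1}
    (hm : m ∈ W) : r m ∈ W :=
  W.smul_mem ⟨r, hr⟩ hm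

lemma fst_mem (W : Submodule (opAlgebra t M) (M.M0 × M.M1)) {m : M.M0 × M.M1}
    (hm : m ∈ W) : (m.1, (0 : M.M1)) ∈ W :=
  apply_mem_of_mem_opAlgebra W (Algebra.subset_adjoin (Or.inl (Or.inl rfl))) hm

lemma snd_mem (W : Submodule (opAlgebra t M) (M.M0 × M.M1)) {m : M.M0 × M.M1}
    (hm : m ∈ W) : ((0 : M.M0), m.2) ∈ W :=
  apply_mem_of_mem_opAlgebra W (Algebra.subset_adjoin (Or.inl (Or.inr rfl))) hm

/-- A submodule over `opAlgebra` as a `t`-invariant subsupermodule. -/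
def TSub.ofSubmodule (W : Submodule (opAlgebra t M) (M.M0 × M.M1)) : TSub t M where
  S0 := (W.restrictScalars ℂ).comap (LinearMap.inl ℂ M.M0 M.M1)
  S1 := (W.restrictScalars ℂ).comap (LinearMap.inr ℂ M.M0 M.M1)
  inv00 := fun z hz m hm => by
    have := apply_mem_of_mem_opAlgebra W
      (Algebra.subset_adjoin (Or.inr (Or.inl ⟨z, hz, rfl⟩))) hm
    simpa using this
  inv01 := fun z hz m hm => by
    have := apply_mem_of_mem_opAlgebra W
      (Algebra.subset_adjoin (Or.inr (Or.inl ⟨z, hz, rfl⟩))) hm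
    simpa using this
  inv10 := fun z hz m hm => by
    have := apply_mem_of_mem_opAlgebra W
      (Algebra.subset_adjoin (Or.inr (Or.inr ⟨z, hz, rfl⟩))) hm
    simpa using this
  inv11 := fun z hz m hm => by
    have := apply_mem_of_mem_opAlgebra W
      (Algebra.subset_adjoin (Or.inr (Or.inr ⟨z, hz, rfl⟩))) hm
    simpa using this

lemma TSub.mem_ofSubmodule_S0 (W : Submodule (opAlgebra t M) (M.M0 × M.M1)) (m : M.M0) :
    m ∈ (TSub.ofSubmodule W).S0 ↔ (m, (0 : M.M1)) ∈ W := Iff.rfl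

lemma TSub.mem_ofSubmodule_S1 (W : Submodule (opAlgebra t M) (M.M0 × M.M1)) (m : M.M1) :
    m ∈ (TSub.ofSubmodule W).S1 ↔ ((0 : M.M0), m) ∈ W := Iff.rfl

lemma TSub.toSubmodule_ofSubmodule (W : Submodule (opAlgebra t M) (M.M0 × M.M1)) :
    (TSub.ofSubmodule W).toSubmodule = W := by
  ext m
  rw [mem_toSubmodule, mem_ofSubmodule_S0, mem_ofSubmodule_S1]
  refine ⟨fun h => ?_, fun h => ⟨fst_mem W h, snd_mem W h⟩⟩
  simpa using W.add_mem h.1 h.2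

lemma TSub.ofSubmodule_le {W : Submodule (opAlgebra t M) (M.M0 × M.M1)} {S : TSub t M}
    (h : W ≤ S.toSubmodule) :
    (TSub.ofSubmodule W).S0 ≤ S.S0 ∧ (TSub.ofSubmodule W).S1 ≤ S.S1 :=
  ⟨fun _ hm => (h hm).1, fun _ hm => (h hm).2⟩

lemma TSub.IsSimple.isAtom {S : TSub t M} (hS : S.IsSimple) : IsAtom S.toSubmodule := by
  refine ⟨fun h => ?_, fun W hW => ?_⟩
  · have key : ∀ m, m ∈ S.toSubmodule → m = 0 := fun m hm => by
      rwa [h, Submodule.mem_bot] at hm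
    rcases hS.1 with h0 | h1
    · exact h0 ((Submodule.eq_bot_iff _).2 fun m hm =>
        congrArg Prod.fst (key (m, 0) ⟨hm, S.S1.zero_mem⟩))
    · exact h1 ((Submodule.eq_bot_iff _).2 fun m hm =>
        congrArg Prod.snd (key (0, m) ⟨S.S0.zero_mem, hm⟩))
  · obtain ⟨h0, h1⟩ := TSub.ofSubmodule_le hW.le
    rcases hS.2 _ h0 h1 with ⟨e0, e1⟩ | ⟨e0, e1⟩
    · rw [← TSub.toSubmodule_ofSubmodule W, Submodule.eq_bot_iff]
      rintro m ⟨hm0, hm1⟩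
      rw [e0, Submodule.mem_bot] at hm0
      rw [e1, Submodule.mem_bot] at hm1
      exact Prod.ext hm0 hm1
    · refine absurd ?_ hW.not_ge
      rintro m ⟨hm0, hm1⟩
      rw [← TSub.toSubmodule_ofSubmodule W]
      exact ⟨e0 ▸ hm0, e1 ▸ hm1⟩

lemma exists_isCompl_of_sSup_atoms {V : Type*} [AddCommGroup V] [Module ℂ V]
    {A : Subalgebra ℂ (Module.End ℂ V)} (h : sSup {W : Submodule A V | IsAtom W} = ⊤)
    (K : Submodule A V) : ∃ W, IsCompl K W :=
  have := complementedLattice_of_sSup_atoms_eq_top h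
  ComplementedLattice.exists_isCompl K

/-- Every `t`-invariant subsupermodule of a finitely semisimple supermodule has a
`t`-invariant complement. -/
theorem FinSSOver.exists_isCompl (hM : FinSSOver t M) (K : TSub t M) :
    ∃ C : TSub t M, IsCompl K.S0 C.S0 ∧ IsCompl K.S1 C.S1 := by
  obtain ⟨ι, S, -, hS, -, -, h0, h1⟩ := hM
  have htop : sSup {W : Submodule (opAlgebra t M) (M.M0 × M.M1) | IsAtom W} = ⊤ := by
    set A := sSup {W : Submodule (opAlgebra t M) (M.M0 × M.M1) | IsAtom W}
    have hle : ∀ i, (S i).toSubmodule ≤ A := fun i => le_sSup (hS i).isAtom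
    have hA0 : (TSub.ofSubmodule A).S0 = ⊤ := by
      rw [eq_top_iff, ← h0]
      exact iSup_le fun i m hm => hle i ⟨hm, (S i).S1.zero_mem⟩
    have hA1 : (TSub.ofSubmodule A).S1 = ⊤ := by
      rw [eq_top_iff, ← h1]
      exact iSup_le fun i m hm => hle i ⟨(S i).S0.zero_mem, hm⟩
    rw [← TSub.toSubmodule_ofSubmodule A, eq_top_iff]
    exact fun m _ => ⟨hA0 ▸ Submodule.mem_top, hA1 ▸ Submodule.mem_top⟩
  obtain ⟨W, hW⟩ := exists_isCompl_of_sSup_atoms (V := M.M0 × M.M1) htop K.toSubmodule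
  refine ⟨TSub.ofSubmodule W, ⟨?_, ?_⟩, ⟨?_, ?_⟩⟩
  · refine Submodule.disjoint_def.2 fun m hm hm' => ?_
    exact congrArg Prod.fst
      (Submodule.disjoint_def.1 hW.disjoint (m, 0) ⟨hm, K.S1.zero_mem⟩ hm')
  · rw [codisjoint_iff, eq_top_iff]
    intro m _
    obtain ⟨a, ha, b, hb, hab⟩ := Submodule.mem_sup.1
      (hW.sup_eq_top ▸ Submodule.mem_top : (m, (0 : M.M1)) ∈ K.toSubmodule ⊔ W)
    exact Submodule.mem_sup.2 ⟨a.1, ha.1, b.1, fst_mem W hb, congrArg Prod.fst hab⟩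
  · refine Submodule.disjoint_def.2 fun m hm hm' => ?_
    exact congrArg Prod.snd
      (Submodule.disjoint_def.1 hW.disjoint (0, m) ⟨K.S0.zero_mem, hm⟩ hm')
  · rw [codisjoint_iff, eq_top_iff]
    intro m _
    obtain ⟨a, ha, b, hb, hab⟩ := Submodule.mem_sup.1
      (hW.sup_eq_top ▸ Submodule.mem_top : ((0 : M.M0), m) ∈ K.toSubmodule ⊔ W)
    exact Submodule.mem_sup.2 ⟨a.2, ha.2, b.2, snd_mem W hb, congrArg Prod.snd hab⟩

end Semisimple

end SubSuperalgebra

namespace RelHom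

open SuperModule SubSuperalgebra

variable {g : LieSuperalgebra} {t : SubSuperalgebra g}

/-- The kernel of a morphism, as a `t`-invariant subsupermodule. -/
def kerTSub (t : SubSuperalgebra g) {M N : SuperModule g}
    {f : (M.M0 →ₗ[ℂ] N.M0) × (M.M1 →ₗ[ℂ] N.M1)} (hf : IsHom M N f) : TSub t M where
  S0 := LinearMap.ker f.1
  S1 := LinearMap.ker f.2
  inv00 := fun z _ m hm => by
    rw [LinearMap.mem_ker] at hm ⊢; rw [hf.1, hm, map_zero]
  inv01 := fun z _ m hm => by
    rw [LinearMap.mem_ker] at hm ⊢; rw [hf.2.1, hm, map_zero]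
  inv10 := fun z _ m hm => by
    rw [LinearMap.mem_ker] at hm ⊢; rw [hf.2.2.1, hm, map_zero]
  inv11 := fun z _ m hm => by
    rw [LinearMap.mem_ker] at hm ⊢; rw [hf.2.2.2, hm, map_zero]

/-- A complement of the kernel of a surjective linear map is the image of a linear
section. -/
lemma exists_section_of_isCompl_ker {V W : Type*} [AddCommGroup V] [Module ℂ V]
    [AddCommGroup W] [Module ℂ W] {f : V →ₗ[ℂ] W} (hf : Function.Surjective f)
    {C : Submodule ℂ V} (hC : IsCompl (LinearMap.ker f) C) :
    ∃ s : W →ₗ[ℂ] V, (∀ w, s w ∈ C) ∧ (∀ w, f (s w) = w) ∧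
      ∀ v ∈ C, ∀ w, f v = w → v = s w := by
  have hinj : ∀ v ∈ C, ∀ v' ∈ C, f v = f v' → v = v' := fun v hv v' hv' h =>
    sub_eq_zero.1 (Submodule.disjoint_def.1 hC.disjoint (v - v')
      (by rw [LinearMap.mem_ker, map_sub, h, sub_self]) (C.sub_mem hv hv'))
  have hbij : Function.Bijective (f.domRestrict C) := by
    refine ⟨fun c c' h => Subtype.ext (hinj c c.2 c' c'.2 h), fun w => ?_⟩
    obtain ⟨v, rfl⟩ := hf w
    obtain ⟨k, hk, c, hc, rfl⟩ := Submodule.mem_sup.1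
      (hC.sup_eq_top ▸ Submodule.mem_top : v ∈ LinearMap.ker f ⊔ C)
    exact ⟨⟨c, hc⟩, by simp [LinearMap.mem_ker.1 hk]⟩
  let e := LinearEquiv.ofBijective (f.domRestrict C) hbij
  have he : ∀ w, f (e.symm w : V) = w := e.apply_symm_apply
  refine ⟨C.subtype ∘ₗ e.symm.toLinearMap, fun w => (e.symm w).2, he, ?_⟩
  exact fun v hv w h => hinj v hv _ (e.symm w).2 (h.trans (he w).symm)

/-- A surjection whose kernel has a `t`-invariant complement is relatively split. -/
theorem relSplitSurj_of_isCompl {M N : SuperModule g}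
    {f : (M.M0 →ₗ[ℂ] N.M0) × (M.M1 →ₗ[ℂ] N.M1)} (hf : IsHom M N f)
    (h0 : Function.Surjective f.1) (h1 : Function.Surjective f.2) (C : TSub t M)
    (hC0 : IsCompl (LinearMap.ker f.1) C.S0) (hC1 : IsCompl (LinearMap.ker f.2) C.S1) :
    RelSplitSurj t M N f := by
  obtain ⟨s0, hs0, hfs0, hu0⟩ := exists_section_of_isCompl_ker h0 hC0
  obtain ⟨s1, hs1, hfs1, hu1⟩ := exists_section_of_isCompl_ker h1 hC1
  refine ⟨hf, (s0, s1), ⟨fun z hz m => ?_, fun z hz m => ?_, fun z hz m => ?_,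
    fun z hz m => ?_⟩, hfs0, hfs1⟩
  · exact (hu0 _ (C.inv00 z hz _ (hs0 m)) _ (by rw [hf.1, hfs0])).symm
  · exact (hu1 _ (C.inv01 z hz _ (hs1 m)) _ (by rw [hf.2.1, hfs1])).symm
  · exact (hu1 _ (C.inv10 z hz _ (hs0 m)) _ (by rw [hf.2.2.1, hfs0])).symm
  · exact (hu0 _ (C.inv11 z hz _ (hs1 m)) _ (by rw [hf.2.2.2, hfs1])).symm

/-- Every surjection from a finitely semisimple supermodule is relatively split. -/
theorem relSplitSurj_of_finSSOver {M N : SuperModule g} (hM : FinSSOver t M)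
    {f : (M.M0 →ₗ[ℂ] N.M0) × (M.M1 →ₗ[ℂ] N.M1)} (hf : IsHom M N f)
    (h0 : Function.Surjective f.1) (h1 : Function.Surjective f.2) :
    RelSplitSurj t M N f := by
  obtain ⟨C, hC0, hC1⟩ := hM.exists_isCompl (kerTSub t hf)
  exact relSplitSurj_of_isCompl hf h0 h1 C hC0 hC1

theorem IsRelProjective.isProjectiveInD {D : SuperModule g → Prop}
    (hD : ∀ M, D M → FinSSOver t M) {P : SuperModule g} (hP : IsRelProjective t P) :
    IsProjectiveInD D P :=
  fun M N hM _ f hf h0 h1 h hh =>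
    hP M N f (relSplitSurj_of_finSSOver (hD M hM) hf h0 h1) h hh

theorem isRelProjective_of_isInducedFrom {L : SuperModule t.toLie} {X : SuperModule g}
    (hX : IsInducedFrom t L X) : IsRelProjective t X := by
  obtain ⟨j, hj, huniv⟩ := hX
  rintro M N f ⟨hf, s, hs, hs0, hs1⟩ h hh
  obtain ⟨h', ⟨hh', e0, e1⟩, -⟩ := huniv M (s.1 ∘ₗ h.1 ∘ₗ j.1, s.2 ∘ₗ h.2 ∘ₗ j.2)
    ⟨fun x m => (congrArg (s.1 ∘ₗ h.1) (hj.1 x m)).trans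
        ((congrArg s.1 (hh.1 x.1 _)).trans (hs.1 x.1 x.2 _)),
      fun x m => (congrArg (s.2 ∘ₗ h.2) (hj.2.1 x m)).trans
        ((congrArg s.2 (hh.2.1 x.1 _)).trans (hs.2.1 x.1 x.2 _)),
      fun u m => (congrArg (s.2 ∘ₗ h.2) (hj.2.2.1 u m)).trans
        ((congrArg s.2 (hh.2.2.1 u.1 _)).trans (hs.2.2.1 u.1 u.2 _)),
      fun u m => (congrArg (s.1 ∘ₗ h.1) (hj.2.2.2 u m)).trans
        ((congrArg s.1 (hh.2.2.2 u.1 _)).trans (hs.2.2.2 u.1 u.2 _))⟩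
  obtain ⟨_, -, hu⟩ := huniv N (h.1 ∘ₗ j.1, h.2 ∘ₗ j.2)
    ⟨fun x m => (congrArg h.1 (hj.1 x m)).trans (hh.1 x.1 _),
      fun x m => (congrArg h.2 (hj.2.1 x m)).trans (hh.2.1 x.1 _),
      fun u m => (congrArg h.2 (hj.2.2.1 u m)).trans (hh.2.2.1 u.1 _),
      fun u m => (congrArg h.1 (hj.2.2.2 u m)).trans (hh.2.2.2 u.1 _)⟩
  have key : (f.1 ∘ₗ h'.1, f.2 ∘ₗ h'.2) = h :=
    (hu _ ⟨IsHom.comp hh' hf, by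
      rw [LinearMap.comp_assoc, e0]; ext m; exact hs0 _, by
      rw [LinearMap.comp_assoc, e1]; ext m; exact hs1 _⟩).trans (hu h ⟨hh, rfl, rfl⟩).symm
  exact ⟨h', hh', fun m => DFunLike.congr_fun (congrArg Prod.fst key) m,
    fun m => DFunLike.congr_fun (congrArg Prod.snd key) m⟩

theorem IsRelProjective.of_retract {P Q : SuperModule g} (hQ : IsRelProjective t Q)
    {i : (P.M0 →ₗ[ℂ] Q.M0) × (P.M1 →ₗ[ℂ] Q.M1)} (hi : IsHom P Q i)
    {r : (Q.M0 →ₗ[ℂ] P.M0) × (Q.M1 →ₗ[ℂ] P.M1)} (hr : IsHom Q P r)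
    (h0 : ∀ m, r.1 (i.1 m) = m) (h1 : ∀ m, r.2 (i.2 m) = m) : IsRelProjective t P := by
  intro M N f hf h hh
  obtain ⟨h', hh', e0, e1⟩ := hQ M N f hf _ (IsHom.comp hr hh)
  exact ⟨_, IsHom.comp hi hh', fun m => by simp [e0, h0], fun m => by simp [e1, h1]⟩

end RelHom

namespace SuperModule

open RelHom

variable {g : LieSuperalgebra} {t : SubSuperalgebra g}

section DirectSum

variable {ι : Type} (Mi : ι → SuperModule g)

/-- The direct sum of a family of supermodules. -/
def directSum : SuperModule g where
  M0 := Π₀ i, (Mi i).M0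
  M1 := Π₀ i, (Mi i).M1
  a00 := LinearMap.mk₂ ℂ
    (fun x m => DFinsupp.mapRange.linearMap (fun i => (Mi i).a00 x) m)
    (fun _ _ _ => by ext; simp) (fun _ _ _ => by ext; simp)
    (fun _ _ _ => map_add _ _ _) (fun _ _ _ => map_smul _ _ _)
  a01 := LinearMap.mk₂ ℂ
    (fun x m => DFinsupp.mapRange.linearMap (fun i => (Mi i).a01 x) m)
    (fun _ _ _ => by ext; simp) (fun _ _ _ => by ext; simp)
    (fun _ _ _ => map_add _ _ _) (fun _ _ _ => map_smul _ _ _)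
  a10 := LinearMap.mk₂ ℂ
    (fun x m => DFinsupp.mapRange.linearMap (fun i => (Mi i).a10 x) m)
    (fun _ _ _ => by ext; simp) (fun _ _ _ => by ext; simp)
    (fun _ _ _ => map_add _ _ _) (fun _ _ _ => map_smul _ _ _)
  a11 := LinearMap.mk₂ ℂ
    (fun x m => DFinsupp.mapRange.linearMap (fun i => (Mi i).a11 x) m)
    (fun _ _ _ => by ext; simp) (fun _ _ _ => by ext; simp)
    (fun _ _ _ => map_add _ _ _) (fun _ _ _ => map_smul _ _ _)
  rel_00_0 := fun _ _ _ => by ext i; simp [(Mi i).rel_00_0]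
  rel_00_1 := fun _ _ _ => by ext i; simp [(Mi i).rel_00_1]
  rel_01_0 := fun _ _ _ => by ext i; simp [(Mi i).rel_01_0]
  rel_01_1 := fun _ _ _ => by ext i; simp [(Mi i).rel_01_1]
  rel_11_0 := fun _ _ _ => by ext i; simp [(Mi i).rel_11_0]
  rel_11_1 := fun _ _ _ => by ext i; simp [(Mi i).rel_11_1]

variable [DecidableEq ι]

/-- The inclusion of a summand in a direct sum. -/
def directSumIncl (i : ι) :
    ((Mi i).M0 →ₗ[ℂ] (directSum Mi).M0) × ((Mi i).M1 →ₗ[ℂ] (directSum Mi).M1) :=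
  (DFinsupp.lsingle (M := fun i => (Mi i).M0) i, DFinsupp.lsingle (M := fun i => (Mi i).M1) i)

lemma isHom_directSumIncl (i : ι) : IsHom (Mi i) (directSum Mi) (directSumIncl Mi i) :=
  ⟨fun x _ => (DFinsupp.mapRange_single (f := fun i => (Mi i).a00 x)
      (hf := fun _ => map_zero _)).symm,
    fun x _ => (DFinsupp.mapRange_single (f := fun i => (Mi i).a01 x)
      (hf := fun _ => map_zero _)).symm,
    fun x _ => (DFinsupp.mapRange_single (f := fun i => (Mi i).a10 x)
      (hf := fun _ => map_zero _)).symm,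
    fun x _ => (DFinsupp.mapRange_single (f := fun i => (Mi i).a11 x)
      (hf := fun _ => map_zero _)).symm⟩

/-- The summands of a finitely supported product are independent. -/
lemma iSupIndep_range_lsingle (V : ι → Type) [∀ i, AddCommGroup (V i)]
    [∀ i, Module ℂ (V i)] :
    iSupIndep fun i => LinearMap.range (DFinsupp.lsingle (R := ℂ) (M := V) i) := by
  intro i
  refine Submodule.disjoint_def.2 ?_
  rintro _ ⟨a, rfl⟩ ha
  have hle : ⨆ j, ⨆ (_ : j ≠ i), LinearMap.range (DFinsupp.lsingle (R := ℂ) (M := V) j) ≤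
      LinearMap.ker (DFinsupp.lapply (R := ℂ) (M := V) i) := by
    refine iSup₂_le fun j hj => ?_
    rintro _ ⟨b, rfl⟩
    simp [DFinsupp.single_eq_of_ne hj.symm]
  have h := hle ha
  rw [LinearMap.mem_ker] at h
  simp only [DFinsupp.lapply_apply, DFinsupp.lsingle_apply, DFinsupp.single_eq_same] at h
  rw [h, map_zero]

theorem isDirectSumOf_directSum : IsDirectSumOf (directSum Mi) Mi :=
  ⟨directSumIncl Mi, isHom_directSumIncl Mi,
    fun _ => ⟨DFinsupp.single_injective (β := fun i => (Mi i).M0),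
      DFinsupp.single_injective (β := fun i => (Mi i).M1)⟩,
    iSupIndep_range_lsingle fun i => (Mi i).M0, iSupIndep_range_lsingle fun i => (Mi i).M1,
    DFinsupp.iSup_range_lsingle (R := ℂ) (M := fun i => (Mi i).M0),
    DFinsupp.iSup_range_lsingle (R := ℂ) (M := fun i => (Mi i).M1)⟩

variable {Mi}

lemma directSum_ext0 {V : Type*} [AddCommGroup V] [Module ℂ V]
    (F G : (directSum Mi).M0 →ₗ[ℂ] V)
    (h : ∀ i m, F ((directSumIncl Mi i).1 m) = G ((directSumIncl Mi i).1 m)) : F = G :=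
  DFinsupp.lhom_ext h

lemma directSum_ext1 {V : Type*} [AddCommGroup V] [Module ℂ V]
    (F G : (directSum Mi).M1 →ₗ[ℂ] V)
    (h : ∀ i m, F ((directSumIncl Mi i).2 m) = G ((directSumIncl Mi i).2 m)) : F = G :=
  DFinsupp.lhom_ext h

/-- A family of morphisms induces a morphism from the direct sum. -/
theorem exists_directSum_desc {N : SuperModule g}
    (f : ∀ i, ((Mi i).M0 →ₗ[ℂ] N.M0) × ((Mi i).M1 →ₗ[ℂ] N.M1))
    (hf : ∀ i, IsHom (Mi i) N (f i)) :
    ∃ F, IsHom (directSum Mi) N F ∧ (∀ i m, F.1 ((directSumIncl Mi i).1 m) = (f i).1 m) ∧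
      ∀ i m, F.2 ((directSumIncl Mi i).2 m) = (f i).2 m := by
  let F0 : (directSum Mi).M0 →ₗ[ℂ] N.M0 := DFinsupp.lsum ℂ fun i => (f i).1
  let F1 : (directSum Mi).M1 →ₗ[ℂ] N.M1 := DFinsupp.lsum ℂ fun i => (f i).2
  have hF0 : ∀ i m, F0 ((directSumIncl Mi i).1 m) = (f i).1 m :=
    DFinsupp.lsum_single ℂ fun i => (f i).1
  have hF1 : ∀ i m, F1 ((directSumIncl Mi i).2 m) = (f i).2 m :=
    DFinsupp.lsum_single ℂ fun i => (f i).2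
  refine ⟨(F0, F1), ⟨fun x m => ?_, fun x m => ?_, fun x m => ?_, fun x m => ?_⟩, hF0, hF1⟩
  · refine DFunLike.congr_fun (directSum_ext0 (F0 ∘ₗ (directSum Mi).a00 x) (N.a00 x ∘ₗ F0) fun i a => ?_) m
    exact (congrArg F0 ((isHom_directSumIncl Mi i).1 x a)).symm.trans
      ((hF0 i _).trans (((hf i).1 x a).trans (congrArg (N.a00 x) (hF0 i a).symm)))
  · refine DFunLike.congr_fun (directSum_ext1 (F1 ∘ₗ (directSum Mi).a01 x) (N.a01 x ∘ₗ F1) fun i a => ?_) m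
    exact (congrArg F1 ((isHom_directSumIncl Mi i).2.1 x a)).symm.trans
      ((hF1 i _).trans (((hf i).2.1 x a).trans (congrArg (N.a01 x) (hF1 i a).symm)))
  · refine DFunLike.congr_fun (directSum_ext0 (F1 ∘ₗ (directSum Mi).a10 x) (N.a10 x ∘ₗ F0) fun i a => ?_) m
    exact (congrArg F1 ((isHom_directSumIncl Mi i).2.2.1 x a)).symm.trans
      ((hF1 i _).trans (((hf i).2.2.1 x a).trans (congrArg (N.a10 x) (hF0 i a).symm)))
  · refine DFunLike.congr_fun (directSum_ext1 (F0 ∘ₗ (directSum Mi).a11 x) (N.a11 x ∘ₗ F1) fun i a => ?_) m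
    exact (congrArg F0 ((isHom_directSumIncl Mi i).2.2.2 x a)).symm.trans
      ((hF0 i _).trans (((hf i).2.2.2 x a).trans (congrArg (N.a11 x) (hF1 i a).symm)))

theorem isRelProjective_directSum (h : ∀ i, IsRelProjective t (Mi i)) :
    IsRelProjective t (directSum Mi) := by
  intro M N f hf k hk
  choose k' hk' e0 e1 using fun i =>
    h i M N f hf _ (IsHom.comp (isHom_directSumIncl Mi i) hk)
  obtain ⟨F, hF, hF0, hF1⟩ := exists_directSum_desc k' hk'
  exact ⟨F, hF,
    DFunLike.congr_fun (directSum_ext0 (f.1 ∘ₗ F.1) k.1 fun i a =>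
      (congrArg f.1 (hF0 i a)).trans (e0 i a)),
    DFunLike.congr_fun (directSum_ext1 (f.2 ∘ₗ F.2) k.2 fun i a =>
      (congrArg f.2 (hF1 i a)).trans (e1 i a))⟩

end DirectSum

/-- An object of `D` is a quotient of a relatively projective object of `D`. -/
theorem exists_relProjective_cover {D : SuperModule g → Prop}
    (hDinC : ∀ M, D M → SubSuperalgebra.FinSSOver t M)
    (hDsums : ∀ (ι : Type) (Mi : ι → SuperModule g), (∀ i, D (Mi i)) →
      ∀ X, SuperModule.IsDirectSumOf X Mi → D X)
    (hDind : ∀ M, D M → ∀ S : SubSuperalgebra.TSub t M, S.IsSimple →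
      ∀ Lhat, SuperModule.IsInducedFrom t S.toSuperModule Lhat → D Lhat)
    {M : SuperModule g} (hM : D M) :
    ∃ P : SuperModule g, D P ∧ IsRelProjective t P ∧
      ∃ f, IsHom P M f ∧ Function.Surjective f.1 ∧ Function.Surjective f.2 := by
  obtain ⟨ι, S, -, hS, -, -, h0, h1⟩ := hDinC M hM
  classical
  have hincl : ∀ i, IsHom (S i).toSuperModule (M.restrict t)
      ((S i).S0.subtype, (S i).S1.subtype) := fun i =>
    ⟨fun _ _ => rfl, fun _ _ => rfl, fun _ _ => rfl, fun _ _ => rfl⟩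
  have hInd := fun i => isInducedFrom_induced t (S i).toSuperModule
  have hfac : ∀ i, ∃ F, IsHom (induced t (S i).toSuperModule) M F ∧
      (S i).S0 ≤ LinearMap.range F.1 ∧ (S i).S1 ≤ LinearMap.range F.2 := fun i => by
    obtain ⟨j, -, hu⟩ := hInd i
    obtain ⟨F, ⟨hF, e0, e1⟩, -⟩ := hu M _ (hincl i)
    exact ⟨F, hF, fun m hm => ⟨j.1 ⟨m, hm⟩, DFunLike.congr_fun e0 ⟨m, hm⟩⟩,
      fun m hm => ⟨j.2 ⟨m, hm⟩, DFunLike.congr_fun e1 ⟨m, hm⟩⟩⟩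
  choose f hf hr0 hr1 using hfac
  obtain ⟨F, hF, hF0, hF1⟩ := exists_directSum_desc f hf
  refine ⟨_, hDsums ι _ (fun i => hDind M hM (S i) (hS i) _ (hInd i)) _
    (isDirectSumOf_directSum _), isRelProjective_directSum fun i =>
      isRelProjective_of_isInducedFrom (hInd i), F, hF, ?_, ?_⟩
  · rw [← LinearMap.range_eq_top, eq_top_iff, ← h0]
    refine iSup_le fun i => (hr0 i).trans ?_
    rintro _ ⟨a, rfl⟩
    exact ⟨_, hF0 i a⟩
  · rw [← LinearMap.range_eq_top, eq_top_iff, ← h1]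
    refine iSup_le fun i => (hr1 i).trans ?_
    rintro _ ⟨a, rfl⟩
    exact ⟨_, hF1 i a⟩

/-- Projective objects of `D` are relatively projective. -/
theorem IsProjectiveInD.isRelProjective {D : SuperModule g → Prop}
    (hDinC : ∀ M, D M → SubSuperalgebra.FinSSOver t M)
    (hDsums : ∀ (ι : Type) (Mi : ι → SuperModule g), (∀ i, D (Mi i)) →
      ∀ X, SuperModule.IsDirectSumOf X Mi → D X)
    (hDind : ∀ M, D M → ∀ S : SubSuperalgebra.TSub t M, S.IsSimple →
      ∀ Lhat, SuperModule.IsInducedFrom t S.toSuperModule Lhat → D Lhat)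
    {P : SuperModule g} (hDP : D P) (hP : IsProjectiveInD D P) : IsRelProjective t P := by
  obtain ⟨Q, hDQ, hQ, f, hf, h0, h1⟩ :=
    exists_relProjective_cover hDinC hDsums hDind hDP
  obtain ⟨s, hs, e0, e1⟩ := hP Q P hDQ hDP f hf h0 h1 (LinearMap.id, LinearMap.id)
    ⟨fun _ _ => rfl, fun _ _ => rfl, fun _ _ => rfl, fun _ _ => rfl⟩
  exact hQ.of_retract hs hf e0 e1

end SuperModule

section ChainMaps

open CategoryTheory

lemma exists_dependent_sequence {α : ℕ → Type*} {r : ∀ p, α p → α (p + 1) → Prop} (a₀ : α 0)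
    (h₀ : ∃ b, r 0 a₀ b) (h : ∀ p a b, r p a b → ∃ c, r (p + 1) b c) :
    ∃ a : ∀ p, α p, a 0 = a₀ ∧ ∀ p, r p (a p) (a (p + 1)) := by
  choose b₀ hb₀ using h₀
  choose c hc using h
  let s : ∀ p, {x : α p × α (p + 1) // r p x.1 x.2} := fun p =>
    Nat.rec ⟨(a₀, b₀), hb₀⟩ (fun p x => ⟨(x.1.2, c p x.1.1 x.1.2 x.2), hc _ _ _ _⟩) p
  exact ⟨fun p => (s p).1.1, rfl, fun p => (s p).2⟩

variable {C : Type*} [Category* C] [Preadditive C] {X Y : ℕ → C} {dX : ∀ p, X (p + 1) ⟶ X p}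
  {dY : ∀ p, Y (p + 1) ⟶ Y p}

/-- Morphisms from the terms of positive degree of `X` lift along the differentials of
`Y`, as they do if these terms are projective and `Y` is exact. -/
structure LiftsAlong (X : ℕ → C) {Y : ℕ → C} (dY : ∀ p, Y (p + 1) ⟶ Y p) : Prop where
  zero : ∀ m (k : X (m + 1) ⟶ Y 0), ∃ k', k' ≫ dY 0 = k
  succ : ∀ m p (k : X (m + 1) ⟶ Y (p + 1)), k ≫ dY p = 0 → ∃ k', k' ≫ dY (p + 1) = k

lemma LiftsAlong.exists_chainMap (h : LiftsAlong X dY) (hX : ∀ p, dX (p + 1) ≫ dX p = 0)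
    (φ₀ : X 0 ⟶ Y 0) :
    ∃ φ : ∀ p, X p ⟶ Y p, φ 0 = φ₀ ∧ ∀ p, φ (p + 1) ≫ dY p = dX p ≫ φ p :=
  exists_dependent_sequence (α := fun p => X p ⟶ Y p)
    (r := fun p a b => b ≫ dY p = dX p ≫ a) φ₀ (h.zero 0 _)
    fun p a b hab => h.succ (p + 1) p _ (by rw [Category.assoc, hab, reassoc_of% hX p, Limits.zero_comp])

lemma LiftsAlong.exists_homotopy (h : LiftsAlong X dY) (hX : ∀ p, dX (p + 1) ≫ dX p = 0)
    {φ : ∀ p, X p ⟶ Y p} (hφ : ∀ p, φ (p + 1) ≫ dY p = dX p ≫ φ p) (hφ₀ : φ 0 = 0) :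
    ∃ k : ∀ p, X p ⟶ Y (p + 1), k 0 = 0 ∧
      ∀ p, φ (p + 1) = k (p + 1) ≫ dY (p + 1) + dX p ≫ k p := by
  refine exists_dependent_sequence (α := fun p => X p ⟶ Y (p + 1))
    (r := fun p a b => φ (p + 1) = b ≫ dY (p + 1) + dX p ≫ a) 0 ?_ fun p a b hab => ?_
  · obtain ⟨k, hk⟩ := h.succ 0 0 (φ 1) (by rw [hφ, hφ₀, Limits.comp_zero])
    exact ⟨k, by rw [hk, Limits.comp_zero, add_zero]⟩
  · obtain ⟨k, hk⟩ := h.succ (p + 1) (p + 1) (φ (p + 2) - dX (p + 1) ≫ b) (by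
      rw [Preadditive.sub_comp, hφ, Category.assoc, eq_sub_of_add_eq hab.symm,
        Preadditive.comp_sub, reassoc_of% hX p, Limits.zero_comp, sub_zero, sub_self])
    exact ⟨k, by rw [hk, sub_add_cancel]⟩

end ChainMaps

namespace SuperModule

open CategoryTheory SubSuperalgebra RelHom

variable {g : LieSuperalgebra}

instance : Category (SuperModule g) where
  Hom M N := ↥(HomS M N)
  id _ := ⟨(LinearMap.id, LinearMap.id),
    ⟨fun _ _ => rfl, fun _ _ => rfl, fun _ _ => rfl, fun _ _ => rfl⟩⟩
  comp f f' := ⟨(f'.1.1 ∘ₗ f.1.1, f'.1.2 ∘ₗ f.1.2), IsHom.comp f.2 f'.2⟩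

instance : Preadditive (SuperModule g) where
  homGroup M N := inferInstanceAs (AddCommGroup ↥(HomS M N))
  add_comp _ _ _ f f' k := Subtype.ext (Prod.ext (LinearMap.comp_add f.1.1 f'.1.1 k.1.1)
    (LinearMap.comp_add f.1.2 f'.1.2 k.1.2))
  comp_add _ _ _ f k k' := Subtype.ext (Prod.ext (LinearMap.add_comp f.1.1 k'.1.1 k.1.1)
    (LinearMap.add_comp f.1.2 k'.1.2 k.1.2))

/-- An invariant subsupermodule as a supermodule. -/
def ofTSub {M : SuperModule g} (S : TSub (full g) M) : SuperModule g where
  M0 := ↥S.S0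
  M1 := ↥S.S1
  a00 := LinearMap.mk₂ ℂ (fun x m => ⟨M.a00 x m, S.inv00 x Submodule.mem_top m m.2⟩)
    (fun _ _ _ => Subtype.ext (by simp)) (fun _ _ _ => Subtype.ext (by simp))
    (fun _ _ _ => Subtype.ext (by simp)) (fun _ _ _ => Subtype.ext (by simp))
  a01 := LinearMap.mk₂ ℂ (fun x m => ⟨M.a01 x m, S.inv01 x Submodule.mem_top m m.2⟩)
    (fun _ _ _ => Subtype.ext (by simp)) (fun _ _ _ => Subtype.ext (by simp))
    (fun _ _ _ => Subtype.ext (by simp)) (fun _ _ _ => Subtype.ext (by simp))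
  a10 := LinearMap.mk₂ ℂ (fun x m => ⟨M.a10 x m, S.inv10 x Submodule.mem_top m m.2⟩)
    (fun _ _ _ => Subtype.ext (by simp)) (fun _ _ _ => Subtype.ext (by simp))
    (fun _ _ _ => Subtype.ext (by simp)) (fun _ _ _ => Subtype.ext (by simp))
  a11 := LinearMap.mk₂ ℂ (fun x m => ⟨M.a11 x m, S.inv11 x Submodule.mem_top m m.2⟩)
    (fun _ _ _ => Subtype.ext (by simp)) (fun _ _ _ => Subtype.ext (by simp))
    (fun _ _ _ => Subtype.ext (by simp)) (fun _ _ _ => Subtype.ext (by simp))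
  rel_00_0 := fun x y m => Subtype.ext (M.rel_00_0 x y m.1)
  rel_00_1 := fun x y m => Subtype.ext (M.rel_00_1 x y m.1)
  rel_01_0 := fun x u m => Subtype.ext (M.rel_01_0 x u m.1)
  rel_01_1 := fun x u m => Subtype.ext (M.rel_01_1 x u m.1)
  rel_11_0 := fun u v m => Subtype.ext (M.rel_11_0 u v m.1)
  rel_11_1 := fun u v m => Subtype.ext (M.rel_11_1 u v m.1)

/-- The range of a morphism, as an invariant subsupermodule. -/
def rangeTSub {M N : SuperModule g} {f : (M.M0 →ₗ[ℂ] N.M0) × (M.M1 →ₗ[ℂ] N.M1)}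
    (hf : IsHom M N f) : TSub (full g) N where
  S0 := LinearMap.range f.1
  S1 := LinearMap.range f.2
  inv00 := by rintro x - _ ⟨m, rfl⟩; exact ⟨_, hf.1 x m⟩
  inv01 := by rintro x - _ ⟨m, rfl⟩; exact ⟨_, hf.2.1 x m⟩
  inv10 := by rintro x - _ ⟨m, rfl⟩; exact ⟨_, hf.2.2.1 x m⟩
  inv11 := by rintro x - _ ⟨m, rfl⟩; exact ⟨_, hf.2.2.2 x m⟩

/-- A morphism whose values lie in an invariant subsupermodule. -/
lemma isHom_codRestrict {M N : SuperModule g} {f : (M.M0 →ₗ[ℂ] N.M0) × (M.M1 →ₗ[ℂ] N.M1)}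
    (hf : IsHom M N f) (S : TSub (full g) N) (h0 : ∀ m, f.1 m ∈ S.S0)
    (h1 : ∀ m, f.2 m ∈ S.S1) :
    IsHom M (ofTSub S) (f.1.codRestrict S.S0 h0, f.2.codRestrict S.S1 h1) :=
  ⟨fun x m => Subtype.ext (hf.1 x m), fun x m => Subtype.ext (hf.2.1 x m),
    fun x m => Subtype.ext (hf.2.2.1 x m), fun x m => Subtype.ext (hf.2.2.2 x m)⟩

end SuperModule

namespace RelHom

open CategoryTheory SubSuperalgebra SuperModule

variable {g : LieSuperalgebra} {t : SubSuperalgebra g}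

/-- Morphisms from a relatively projective supermodule lift along a morphism whose kernel
has a `t`-invariant complement as soon as their values lie in its range. -/
theorem IsRelProjective.exists_lift {P A B : SuperModule g} (hP : IsRelProjective t P)
    (f : A ⟶ B) (hC : ∃ C : TSub t A,
      IsCompl (LinearMap.ker f.1.1) C.S0 ∧ IsCompl (LinearMap.ker f.1.2) C.S1)
    (k : P ⟶ B) (h0 : LinearMap.range k.1.1 ≤ LinearMap.range f.1.1)
    (h1 : LinearMap.range k.1.2 ≤ LinearMap.range f.1.2) : ∃ k' : P ⟶ A, k' ≫ f = k := by
  obtain ⟨C, hC0, hC1⟩ := hC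
  have hf := isHom_codRestrict f.2 (rangeTSub f.2) (fun m => ⟨m, rfl⟩) fun m => ⟨m, rfl⟩
  have hk := isHom_codRestrict k.2 (rangeTSub f.2) (fun m => h0 ⟨m, rfl⟩)
    fun m => h1 ⟨m, rfl⟩
  have hsplit := relSplitSurj_of_isCompl hf (LinearMap.surjective_rangeRestrict f.1.1)
    (LinearMap.surjective_rangeRestrict f.1.2) C
    ((congrArg (IsCompl · C.S0) (LinearMap.ker_codRestrict _ f.1.1 _)).mpr hC0)
    ((congrArg (IsCompl · C.S1) (LinearMap.ker_codRestrict _ f.1.2 _)).mpr hC1)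
  obtain ⟨k', hk', e0, e1⟩ := hP _ _ _ hsplit _ hk
  exact ⟨⟨k', hk'⟩, Subtype.ext (Prod.ext
    (LinearMap.ext fun m => congrArg Subtype.val (e0 m))
    (LinearMap.ext fun m => congrArg Subtype.val (e1 m)))⟩

namespace SMResolution

variable {M : SuperModule g} (R : SMResolution M)

/-- The terms of the augmented complex of a resolution, with `M` in degree zero. -/
def aug : ℕ → SuperModule g
  | 0 => M
  | p + 1 => R.P p

/-- The differentials of the augmented complex of a resolution. -/
def augD : ∀ p, R.aug (p + 1) ⟶ R.aug p
  | 0 => ⟨R.eps, R.heps⟩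
  | p + 1 => ⟨R.d p, R.hd p⟩

lemma range_augD : ∀ p, LinearMap.range (R.augD (p + 1)).1.1 = LinearMap.ker (R.augD p).1.1 ∧
    LinearMap.range (R.augD (p + 1)).1.2 = LinearMap.ker (R.augD p).1.2
  | 0 => ⟨R.exact1a, R.exact1b⟩
  | p + 1 => ⟨R.exacta p, R.exactb p⟩

lemma augD_comp_augD (p : ℕ) : R.augD (p + 1) ≫ R.augD p = 0 :=
  Subtype.ext (Prod.ext
    (LinearMap.ext fun m => LinearMap.mem_ker.1 ((R.range_augD p).1.le ⟨m, rfl⟩))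
    (LinearMap.ext fun m => LinearMap.mem_ker.1 ((R.range_augD p).2.le ⟨m, rfl⟩)))

end SMResolution

variable {M : SuperModule g} {R R' : SMResolution M}

lemma IsRelProjRes.exists_isCompl (hR : IsRelProjRes t R) : ∀ p, ∃ C : TSub t (R.aug (p + 1)),
    IsCompl (LinearMap.ker (R.augD p).1.1) C.S0 ∧ IsCompl (LinearMap.ker (R.augD p).1.2) C.S1
  | 0 => hR.split0
  | p + 1 => hR.splits p

lemma IsRelProjRes.liftsAlong (hR : IsRelProjRes t R) (hR' : IsRelProjRes t R') :
    LiftsAlong R.aug R'.augD where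
  zero m k := (hR.projective m).exists_lift (R'.augD 0) (hR'.exists_isCompl 0) k
    (le_top.trans_eq R'.exact0a.symm) (le_top.trans_eq R'.exact0b.symm)
  succ m p k hk := (hR.projective m).exists_lift (R'.augD (p + 1))
    (hR'.exists_isCompl (p + 1)) k
    (by
      rw [(R'.range_augD p).1]
      rintro _ ⟨m, rfl⟩
      exact DFunLike.congr_fun (congrArg (fun f => f.1.1) hk) m)
    (by
      rw [(R'.range_augD p).2]
      rintro _ ⟨m, rfl⟩
      exact DFunLike.congr_fun (congrArg (fun f => f.1.2) hk) m)

/-- Linear maps in both directions which are mutually inverse on cocycles, up to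
coboundaries, induce an isomorphism of the quotients. -/
lemma nonempty_subquot_equiv {X Y X' Y' : Type} [AddCommGroup X] [Module ℂ X]
    [AddCommGroup Y] [Module ℂ Y] [AddCommGroup X'] [Module ℂ X'] [AddCommGroup Y']
    [Module ℂ Y'] {f : X →ₗ[ℂ] Y} {f' : X' →ₗ[ℂ] Y'} {B : Submodule ℂ X}
    {B' : Submodule ℂ X'} (a : X →ₗ[ℂ] X') (b : X' →ₗ[ℂ] X)
    (ha : ∀ x ∈ LinearMap.ker f, a x ∈ LinearMap.ker f')
    (hb : ∀ x ∈ LinearMap.ker f', b x ∈ LinearMap.ker f)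
    (haB : ∀ x ∈ B, a x ∈ B') (hbB : ∀ x ∈ B', b x ∈ B)
    (hba : ∀ x ∈ LinearMap.ker f, b (a x) - x ∈ B)
    (hab : ∀ x ∈ LinearMap.ker f', a (b x) - x ∈ B') :
    Nonempty (Subquot f B ≃ₗ[ℂ] Subquot f' B') :=
  ⟨LinearEquiv.ofLinearMap
    (Submodule.mapQ _ _ (a.restrict ha) fun x hx => haB x.1 hx)
    (Submodule.mapQ _ _ (b.restrict hb) fun x hx => hbB x.1 hx)
    (Submodule.linearMap_qext _ (LinearMap.ext fun x =>
      (Submodule.Quotient.eq _).2 (hab x.1 x.2)))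
    (Submodule.linearMap_qext _ (LinearMap.ext fun x =>
      (Submodule.Quotient.eq _).2 (hba x.1 x.2)))⟩

/-- Precomposition with a morphism. -/
def precomp {P Q : SuperModule g} (φ : P ⟶ Q) (N : SuperModule g) :
    ↥(HomS Q N) →ₗ[ℂ] ↥(HomS P N) :=
  LinearMap.restrict
    ((LinearMap.lcomp ℂ N.M0 φ.1.1).prodMap (LinearMap.lcomp ℂ N.M1 φ.1.2))
    (fun _ hf => IsHom.comp φ.2 hf)

lemma precomp_mem_ker_extDiff {φ : ∀ p, R.aug p ⟶ R'.aug p}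
    (hφ : ∀ p, φ (p + 1) ≫ R'.augD p = R.augD p ≫ φ p) {N : SuperModule g} {p : ℕ}
    (f : ↥(HomS (R'.P p) N)) (hf : f ∈ LinearMap.ker (extDiff R' N p)) :
    precomp (P := R.P p) (φ (p + 1)) N f ∈ LinearMap.ker (extDiff R N p) := by
  have hf' : R'.augD (p + 1) ≫ (show R'.aug (p + 1) ⟶ N from f) = 0 := hf
  change R.augD (p + 1) ≫ φ (p + 1) ≫ (show R'.aug (p + 1) ⟶ N from f) = 0
  rw [← Category.assoc, ← hφ, Category.assoc, hf', Limits.comp_zero]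

lemma precomp_mem_extCobound {φ : ∀ p, R.aug p ⟶ R'.aug p}
    (hφ : ∀ p, φ (p + 1) ≫ R'.augD p = R.augD p ≫ φ p) {N : SuperModule g} :
    ∀ {p : ℕ} (f : ↥(HomS (R'.P p) N)), f ∈ extCobound R' N p →
      precomp (P := R.P p) (φ (p + 1)) N f ∈ extCobound R N p
  | 0, _, hf => (Submodule.mem_bot ℂ).2
    ((congrArg (precomp (P := R.P 0) (Q := R'.P 0) (φ 1) N) ((Submodule.mem_bot ℂ).1 hf)).trans
      (map_zero _))
  | q + 1, _, ⟨k, rfl⟩ => by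
    refine ⟨precomp (φ (q + 1)) N k, ?_⟩
    change R.augD (q + 1) ≫ φ (q + 1) ≫ (show R'.aug (q + 1) ⟶ N from k) =
      φ (q + 2) ≫ R'.augD (q + 1) ≫ (show R'.aug (q + 1) ⟶ N from k)
    rw [← Category.assoc, ← hφ, Category.assoc]

/-- A chain endomorphism of a relative projective resolution lifting the identity acts on
cocycles as the identity, up to coboundaries. -/
lemma IsRelProjRes.precomp_sub_mem_extCobound (hR : IsRelProjRes t R)
    {φ : ∀ p, R.aug p ⟶ R.aug p} (hφ : ∀ p, φ (p + 1) ≫ R.augD p = R.augD p ≫ φ p)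
    (hφ₀ : φ 0 = 𝟙 _) {N : SuperModule g} {p : ℕ} (f : ↥(HomS (R.P p) N))
    (hf : f ∈ LinearMap.ker (extDiff R N p)) :
    precomp (P := R.P p) (φ (p + 1)) N f - f ∈ extCobound R N p := by
  obtain ⟨k, hk₀, hk⟩ := (hR.liftsAlong hR).exists_homotopy R.augD_comp_augD
    (φ := fun p => φ p - 𝟙 _)
    (fun p => by simp [Preadditive.sub_comp, Preadditive.comp_sub, hφ]) (by simp [hφ₀])
  have key : ∀ f : R.aug (p + 1) ⟶ N, R.augD (p + 1) ≫ f = 0 →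
      φ (p + 1) ≫ f - f = R.augD p ≫ k p ≫ f := fun f hf => by
    have h := congrArg (· ≫ f) (hk p)
    simpa [Preadditive.sub_comp, Preadditive.add_comp, hf] using h
  replace key := key f hf
  cases p with
  | zero =>
    have hzero : ∀ f : R.aug 1 ⟶ N, R.augD 0 ≫ k 0 ≫ f = 0 := fun f => by
      rw [hk₀, Limits.zero_comp, Limits.comp_zero]
    exact (Submodule.mem_bot ℂ).2 (key.trans (hzero f))
  | succ q => exact ⟨precomp (k (q + 1)) N f, key.symm⟩

/-- Relative Ext does not depend on the choice of a relative projective resolution. -/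
theorem IsRelProjRes.nonempty_relExt_equiv (hR : IsRelProjRes t R) (hR' : IsRelProjRes t R')
    (N : SuperModule g) (p : ℕ) : Nonempty (relExt R N p ≃ₗ[ℂ] relExt R' N p) := by
  obtain ⟨φ, hφ₀, hφ⟩ := (hR.liftsAlong hR').exists_chainMap R.augD_comp_augD (𝟙 M)
  obtain ⟨ψ, hψ₀, hψ⟩ := (hR'.liftsAlong hR).exists_chainMap R'.augD_comp_augD (𝟙 M)
  refine nonempty_subquot_equiv (precomp (ψ (p + 1)) N) (precomp (φ (p + 1)) N)
    (precomp_mem_ker_extDiff hψ) (precomp_mem_ker_extDiff hφ)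
    (precomp_mem_extCobound hψ) (precomp_mem_extCobound hφ) ?_ ?_
  · exact hR.precomp_sub_mem_extCobound (φ := fun p => φ p ≫ ψ p)
      (fun p => by rw [Category.assoc, hψ, reassoc_of% hφ]) (by
        rw [hφ₀, hψ₀]; exact Category.id_comp _)
  · exact hR'.precomp_sub_mem_extCobound (φ := fun p => ψ p ≫ φ p)
      (fun p => by rw [Category.assoc, hφ, reassoc_of% hψ]) (by
        rw [hφ₀, hψ₀]; exact Category.id_comp _)

/-- Projective resolutions in `D` are relative projective resolutions. -/
theorem IsProjResInD.isRelProjRes {D : SuperModule g → Prop}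
    (hDinC : ∀ M, D M → SubSuperalgebra.FinSSOver t M)
    (hDsums : ∀ (ι : Type) (Mi : ι → SuperModule g), (∀ i, D (Mi i)) →
      ∀ X, SuperModule.IsDirectSumOf X Mi → D X)
    (hDind : ∀ M, D M → ∀ S : SubSuperalgebra.TSub t M, S.IsSimple →
      ∀ Lhat, SuperModule.IsInducedFrom t S.toSuperModule Lhat → D Lhat)
    (hR : IsProjResInD D R) : IsRelProjRes t R where
  projective p := (hR p).2.isRelProjective hDinC hDsums hDind (hR p).1
  split0 := (hDinC _ (hR 0).1).exists_isCompl (kerTSub t R.heps)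
  splits p := (hDinC _ (hR (p + 1)).1).exists_isCompl (kerTSub t (R.hd p))

end RelHom

/-- Let `g` be a Lie superalgebra over `ℂ` and `t ⊆ g` a Lie subsuperalgebra such that
`g` is finitely semisimple as a `t`-supermodule under the adjoint action.  Let `𝒟` be a
full subcategory of `𝒞_{(g,t)}` (given by its class `D` of objects), closed under
direct sums, and such that whenever a finite-dimensional simple `t`-supermodule `L`
appears as a composition factor of an object of `𝒟` (equivalently, since objects of
`𝒟` are finitely semisimple over `t`, as a simple `t`-subsupermodule), the induced
supermodule `L̂ = U(g) ⊗_{U(t)} L` lies in `𝒟`.  Then `𝒟` has enough projectives, and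
for all objects `M, N` of `𝒟` and all `p ≥ 0`,
`Ext^p_𝒟(M,N) ≅ Ext^p_{(U(g),U(t))}(M,N)` (computed from a projective resolution in
`𝒟` and from a `(U(g),U(t))`-relative projective resolution, respectively). -/
theorem enough_projectives_and_ext_comparison
    (g : LieSuperalgebra) (t : SubSuperalgebra g)
    (hss : g.AdjFinSS t)
    (D : SuperModule g → Prop)
    (hDinC : ∀ M, D M → SubSuperalgebra.FinSSOver t M)
    (hDsums : ∀ (ι : Type) (Mi : ι → SuperModule g), (∀ i, D (Mi i)) →
      ∀ X, SuperModule.IsDirectSumOf X Mi → D X)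
    (hDind : ∀ M, D M → ∀ S : SubSuperalgebra.TSub t M, S.IsSimple →
      ∀ Lhat, SuperModule.IsInducedFrom t S.toSuperModule Lhat → D Lhat) :
    (∀ M, D M → ∃ P : SuperModule g, D P ∧ SuperModule.IsProjectiveInD D P ∧
      ∃ f, SuperModule.IsHom P M f ∧ Function.Surjective f.1 ∧ Function.Surjective f.2) ∧
    (∀ M N, D M → D N →
      ∀ RD : RelHom.SMResolution M, RelHom.IsProjResInD D RD →
      ∀ R : RelHom.SMResolution M, RelHom.IsRelProjRes t R →
      ∀ p : ℕ, Nonempty (RelHom.relExt RD N p ≃ₗ[ℂ] RelHom.relExt R N p)) := by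
  refine ⟨fun M hM => ?_, fun M N _ _ RD hRD R hR p =>
    (hRD.isRelProjRes hDinC hDsums hDind).nonempty_relExt_equiv hR N p⟩
  obtain ⟨P, hDP, hP, hf⟩ := SuperModule.exists_relProjective_cover hDinC hDsums hDind hM
  exact ⟨P, hDP, hP.isProjectiveInD hDinC, hf⟩
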